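/- Let p ≥ 1 be an integer, m > 0 an irrational real number, and k0 ≥ 3 an integer. Then there exist constants M > 0, c > 0 and C > 0 (depending only on p, m, k0) such that for every ρ ∈ (0, M) there exist real numbers α and ω with α ≥ c·ρ^(2p) and |ω² − (1+m)| ≤ C·ρ^(2p+1), and a function u : ℝ × ℝ → ℝ of class C^{k0} such that: (i) for all (t,x), ω²·∂_t² u(t,x) − ∂_x² u(t,x) − ω·α·∂_t ∂_x² u(t,x) + m·u(t,x) = ω^(2p+1)·(∂_t u(t,x))^(2p+1); (ii) u(t,0) = u(t,π) = 0 for all t; (iii) u(t + 2π, x) = u(t,x) for all (t,x); (iv) there is a function v : ℝ × ℝ → ℝ with u(t,x) = ρ·cos(t)·sin(x) + v(t,x) for all (t,x) and sup_{(t,x)} |v(t,x)| ≤ C·ρ^(2p+1/2). -/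

import Mathlib

/-- Partial derivative in the first variable. -/
noncomputable def pdt (u : ℝ → ℝ → ℝ) (t x : ℝ) : ℝ := deriv (fun s => u s x) t

/-- Second partial derivative in the first variable. -/
noncomputable def pdtt (u : ℝ → ℝ → ℝ) (t x : ℝ) : ℝ := deriv (fun s => pdt u s x) t

/-- Second partial derivative in the second variable. -/
noncomputable def pdxx (u : ℝ → ℝ → ℝ) (t x : ℝ) : ℝ :=
  deriv (fun y => deriv (fun z => u t z) y) x

/-- Mixed partial derivative ∂ₜ∂ₓ². -/
noncomputable def pdtxx (u : ℝ → ℝ → ℝ) (t x : ℝ) : ℝ := deriv (fun s => pdxx u s x) t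

/-! Part 1: weighted coefficient algebra -/
namespace SDB
open Complex

abbrev G := ℤ × ℤ

noncomputable def W (n : G) : ℝ := 2 ^ (n.1.natAbs + n.2.natAbs)

lemma W_pos (n : G) : 0 < W n := by unfold W; positivity

lemma W_one_le (n : G) : 1 ≤ W n := by unfold W; exact one_le_pow₀ (by norm_num)

lemma W_add_le (a b : G) : W (a + b) ≤ W a * W b := by
  unfold W
  rw [← pow_add]
  apply pow_le_pow_right₀ (by norm_num)
  have h1 := Int.natAbs_add_le a.1 b.1
  have h2 := Int.natAbs_add_le a.2 b.2
  simp only [Prod.fst_add, Prod.snd_add]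
  omega

lemma W_le (n k : G) : W n ≤ W k * W (n - k) := by
  have := W_add_le k (n - k); simpa using this

def A (f : G → ℂ) : Prop := Summable fun n => ‖f n‖ * W n
noncomputable def N (f : G → ℂ) : ℝ := ∑' n, ‖f n‖ * W n

lemma N_nonneg (f : G → ℂ) : 0 ≤ N f :=
  tsum_nonneg fun n => mul_nonneg (norm_nonneg _) (W_pos n).le

lemma A.mono {f g : G → ℂ} (hg : A g) {C : ℝ} (h : ∀ n, ‖f n‖ ≤ C * ‖g n‖) : A f := by
  refine Summable.of_nonneg_of_le (fun n => mul_nonneg (norm_nonneg _) (W_pos n).le) (fun n => ?_)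
    (hg.mul_left C)
  calc ‖f n‖ * W n ≤ (C * ‖g n‖) * W n := mul_le_mul_of_nonneg_right (h n) (W_pos n).le
    _ = _ := by ring

lemma N_mono {f g : G → ℂ} (hg : A g) {C : ℝ} (h : ∀ n, ‖f n‖ ≤ C * ‖g n‖) : N f ≤ C * N g := by
  unfold N
  rw [← tsum_mul_left]
  refine Summable.tsum_le_tsum (fun n => ?_) (hg.mono h) (hg.mul_left C)
  calc ‖f n‖ * W n ≤ (C * ‖g n‖) * W n := mul_le_mul_of_nonneg_right (h n) (W_pos n).le
    _ = _ := by ring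

lemma A.add {f g : G → ℂ} (hf : A f) (hg : A g) : A (f + g) := by
  refine Summable.of_nonneg_of_le (fun n => mul_nonneg (norm_nonneg _) (W_pos n).le) (fun n => ?_)
    (Summable.add hf hg)
  rw [← add_mul]
  exact mul_le_mul_of_nonneg_right (norm_add_le _ _) (W_pos n).le

lemma N_add_le {f g : G → ℂ} (hf : A f) (hg : A g) : N (f + g) ≤ N f + N g := by
  unfold N
  rw [← Summable.tsum_add hf hg]
  refine Summable.tsum_le_tsum (fun n => ?_) (hf.add hg) (Summable.add hf hg)
  rw [← add_mul]
  exact mul_le_mul_of_nonneg_right (norm_add_le _ _) (W_pos n).le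

lemma A.neg {f : G → ℂ} (hf : A f) : A (-f) := hf.mono (C := 1) (by simp)

lemma A.sub {f g : G → ℂ} (hf : A f) (hg : A g) : A (f - g) := by
  rw [sub_eq_add_neg]; exact hf.add hg.neg

lemma norm_le_N {f : G → ℂ} (hf : A f) (n : G) : ‖f n‖ ≤ N f := by
  have h1 : ‖f n‖ * W n ≤ N f :=
    hf.le_tsum n (fun m _ => mul_nonneg (norm_nonneg _) (W_pos m).le)
  have := W_one_le n
  nlinarith [norm_nonneg (f n)]

lemma A.summable_norm {f : G → ℂ} (hf : A f) : Summable fun n => ‖f n‖ :=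
  Summable.of_nonneg_of_le (fun _ => norm_nonneg _)
    (fun n => le_mul_of_one_le_right (norm_nonneg _) (W_one_le n)) hf

lemma tsum_norm_le_N {f : G → ℂ} (hf : A f) : ∑' n, ‖f n‖ ≤ N f :=
  hf.summable_norm.tsum_le_tsum
    (fun n => le_mul_of_one_le_right (norm_nonneg _) (W_one_le n)) hf

/-- (n,k) ↦ (k, n-k) -/
def shear : G × G ≃ G × G where
  toFun q := (q.2, q.1 - q.2)
  invFun q := (q.1 + q.2, q.1)
  left_inv q := by ext <;> simp
  right_inv q := by ext <;> simp

noncomputable def conv (f g : G → ℂ) (n : G) : ℂ := ∑' k, f k * g (n - k)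

lemma big_summable {f g : G → ℂ} (hf : A f) (hg : A g) :
    Summable fun q : G × G => (‖f q.2‖ * W q.2) * (‖g (q.1 - q.2)‖ * W (q.1 - q.2)) := by
  have h := hf.mul_of_nonneg hg (fun n => mul_nonneg (norm_nonneg _) (W_pos n).le)
    (fun n => mul_nonneg (norm_nonneg _) (W_pos n).le)
  exact (shear.summable_iff (f := fun x : G × G => (‖f x.1‖ * W x.1) * (‖g x.2‖ * W x.2))).2 h

lemma big_tsum {f g : G → ℂ} (hf : A f) (hg : A g) :
    ∑' q : G × G, (‖f q.2‖ * W q.2) * (‖g (q.1 - q.2)‖ * W (q.1 - q.2)) = N f * N g := by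
  unfold N
  have h := hf.mul_of_nonneg hg (fun n => mul_nonneg (norm_nonneg _) (W_pos n).le)
    (fun n => mul_nonneg (norm_nonneg _) (W_pos n).le)
  rw [Summable.tsum_mul_tsum hf hg h]
  exact shear.tsum_eq (f := fun x : G × G => (‖f x.1‖ * W x.1) * (‖g x.2‖ * W x.2))

lemma conv_summable {f g : G → ℂ} (hf : A f) (hg : A g) (n : G) :
    Summable fun k => f k * g (n - k) := by
  refine Summable.of_norm_bounded (g := fun k => ‖f k‖ * N g)
    (hf.summable_norm.mul_right _) fun k => ?_
  rw [norm_mul]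
  exact mul_le_mul_of_nonneg_left (norm_le_N hg _) (norm_nonneg _)

lemma conv_bound {f g : G → ℂ} (hf : A f) (hg : A g) (n : G) :
    ‖conv f g n‖ * W n ≤
      ∑' k, (‖f k‖ * W k) * (‖g (n - k)‖ * W (n - k)) := by
  have hs := (big_summable hf hg).prod_factor n
  have h1 : ‖conv f g n‖ ≤ ∑' k, ‖f k * g (n - k)‖ :=
    norm_tsum_le_tsum_norm (conv_summable hf hg n).norm
  calc ‖conv f g n‖ * W n ≤ (∑' k, ‖f k * g (n - k)‖) * W n :=
        mul_le_mul_of_nonneg_right h1 (W_pos n).le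
    _ = ∑' k, ‖f k * g (n - k)‖ * W n := tsum_mul_right.symm
    _ ≤ _ := by
        refine Summable.tsum_le_tsum (fun k => ?_) ((conv_summable hf hg n).norm.mul_right _) hs
        rw [norm_mul]
        calc ‖f k‖ * ‖g (n - k)‖ * W n ≤ ‖f k‖ * ‖g (n - k)‖ * (W k * W (n - k)) :=
              mul_le_mul_of_nonneg_left (W_le n k) (by positivity)
          _ = _ := by ring

lemma A.conv {f g : G → ℂ} (hf : A f) (hg : A g) : A (conv f g) :=
  Summable.of_nonneg_of_le (fun n => mul_nonneg (norm_nonneg _) (W_pos n).le)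
    (fun n => conv_bound hf hg n) (big_summable hf hg).prod

lemma N_conv_le {f g : G → ℂ} (hf : A f) (hg : A g) : N (SDB.conv f g) ≤ N f * N g := by
  rw [← big_tsum hf hg, (big_summable hf hg).tsum_prod]
  exact Summable.tsum_le_tsum (fun n => conv_bound hf hg n) (hf.conv hg) (big_summable hf hg).prod

lemma conv_sub_conv {f g f' g' : G → ℂ} (hf : A f) (hg : A g) (hf' : A f') (hg' : A g') :
    SDB.conv f g - SDB.conv f' g' = SDB.conv (f - f') g + SDB.conv f' (g - g') := by
  ext n
  have e := (conv_summable (hf.sub hf') hg n).tsum_add (conv_summable hf' (hg.sub hg') n)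
  simp only [Pi.add_apply]
  unfold SDB.conv
  rw [← e]
  simp only [Pi.sub_apply]
  rw [← (conv_summable hf hg n).tsum_sub (conv_summable hf' hg' n)]
  refine tsum_congr fun k => ?_
  ring

/-- pw f k = f^{k+1} -/
noncomputable def pw (f : G → ℂ) : ℕ → G → ℂ
  | 0 => f
  | k + 1 => SDB.conv (pw f k) f

lemma A.pw {f : G → ℂ} (hf : A f) (k : ℕ) : A (pw f k) := by
  induction k with
  | zero => exact hf
  | succ k ih => exact ih.conv hf

lemma N_pw_le {f : G → ℂ} (hf : A f) {B : ℝ} (hB : N f ≤ B) (k : ℕ) :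
    N (SDB.pw f k) ≤ B ^ (k + 1) := by
  induction k with
  | zero => simpa [SDB.pw] using hB
  | succ k ih =>
    calc N (SDB.pw f (k + 1)) ≤ N (SDB.pw f k) * N f := N_conv_le (hf.pw k) hf
      _ ≤ B ^ (k + 1) * B := mul_le_mul ih hB (N_nonneg _) ((N_nonneg _).trans ih)
      _ = _ := by ring

lemma N_pw_sub_le {f g : G → ℂ} (hf : A f) (hg : A g) {B : ℝ} (hfB : N f ≤ B) (hgB : N g ≤ B)
    (k : ℕ) : N (SDB.pw f k - SDB.pw g k) ≤ (k + 1) * B ^ k * N (f - g) := by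
  have hB : 0 ≤ B := (N_nonneg _).trans hfB
  induction k with
  | zero => simp [SDB.pw]
  | succ k ih =>
    have e : SDB.pw f (k+1) - SDB.pw g (k+1) = _ := conv_sub_conv (hf.pw k) hf (hg.pw k) hg
    rw [e]
    have h1 := N_add_le (((hf.pw k).sub (hg.pw k)).conv hf) ((hg.pw k).conv (hf.sub hg))
    have h2 := N_conv_le ((hf.pw k).sub (hg.pw k)) hf
    have h3 := N_conv_le (hg.pw k) (hf.sub hg)
    have h4 : N (SDB.pw f k - SDB.pw g k) * N f ≤ ((k + 1) * B ^ k * N (f - g)) * B :=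
      mul_le_mul ih hfB (N_nonneg _) ((N_nonneg _).trans ih)
    have h5 : N (SDB.pw g k) * N (f - g) ≤ B ^ (k+1) * N (f - g) :=
      mul_le_mul_of_nonneg_right (N_pw_le hg hgB k) (N_nonneg _)
    push_cast
    have h6 : ((k + 1) * B ^ k * N (f - g)) * B + B ^ (k+1) * N (f - g)
      = ((k:ℝ) + 1 + 1) * B ^ (k+1) * N (f - g) := by ring
    linarith

/-! symmetries -/
structure Sy (s : ℂ) (f : G → ℂ) : Prop where
  conj : ∀ l j : ℤ, f (-l, -j) = (starRingEnd ℂ) (f (l, j))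
  odd : ∀ l j : ℤ, f (l, -j) = s * f (l, j)
  par : ∀ l j : ℤ, (-1 : ℂ) ^ l * f (l, j) = s * f (l, j)

def reflx : G ≃ G where
  toFun q := (q.1, -q.2)
  invFun q := (q.1, -q.2)
  left_inv q := by simp
  right_inv q := by simp

lemma Sy.conv {s s' : ℂ} {f g : G → ℂ} (hf : Sy s f) (hg : Sy s' g) :
    Sy (s * s') (SDB.conv f g) where
  conj l j := by
    unfold SDB.conv
    rw [Complex.conj_tsum, ← (Equiv.neg G).tsum_eq]
    refine tsum_congr fun k => ?_
    obtain ⟨a, b⟩ := k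
    have h1 := hf.conj a b
    have h2 := hg.conj (l - a) (j - b)
    simp only [Equiv.neg_apply, Prod.neg_mk, Prod.mk_sub_mk, map_mul]
    rw [h1, ← h2]
    congr 3 <;> ring
  odd l j := by
    unfold SDB.conv
    rw [← tsum_mul_left, ← reflx.tsum_eq]
    refine tsum_congr fun k => ?_
    obtain ⟨a, b⟩ := k
    have h1 := hf.odd a b
    have h2 := hg.odd (l - a) (j - b)
    simp only [reflx, Equiv.coe_fn_mk, Prod.mk_sub_mk]
    rw [h1, show (-j - -b : ℤ) = -(j - b) by ring, h2]
    ring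
  par l j := by
    unfold SDB.conv
    rw [← tsum_mul_left, ← tsum_mul_left]
    refine tsum_congr fun k => ?_
    obtain ⟨a, b⟩ := k
    have h1 := hf.par a b
    have h2 := hg.par (l - a) (j - b)
    simp only [Prod.mk_sub_mk]
    have : (-1 : ℂ) ^ l = (-1) ^ a * (-1) ^ (l - a) := by
      rw [← zpow_add₀ (by norm_num)]; congr 1; ring
    rw [this]
    calc _ = ((-1) ^ a * f (a, b)) * ((-1) ^ (l - a) * g (l - a, j - b)) := by ring
      _ = _ := by rw [h1, h2]; ring

lemma Sy.pw {f : G → ℂ} (hf : Sy (-1) f) (k : ℕ) : Sy ((-1) ^ (k + 1)) (SDB.pw f k) := by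
  induction k with
  | zero => simpa [SDB.pw] using hf
  | succ k ih =>
    have := ih.conv hf
    rw [pow_succ]; exact this

lemma Sy.add {s : ℂ} {f g : G → ℂ} (hf : Sy s f) (hg : Sy s g) : Sy s (f + g) where
  conj l j := by simp [hf.conj, hg.conj]
  odd l j := by simp [hf.odd l j, hg.odd l j]; ring
  par l j := by
    have h1 := hf.par l j
    have h2 := hg.par l j
    simp only [Pi.add_apply]
    rw [mul_add, mul_add, h1, h2]

lemma Sy.zero_of_even {f : G → ℂ} (hf : Sy (-1) f) {l : ℤ} (hl : Even l) (j : ℤ) :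
    f (l, j) = 0 := by
  have := hf.par l j
  rw [hl.neg_one_zpow] at this
  linear_combination this / 2

lemma Sy.zero_of_zero {f : G → ℂ} (hf : Sy (-1) f) (l : ℤ) : f (l, 0) = 0 := by
  have := hf.odd l 0
  simp only [neg_zero] at this
  linear_combination this / 2

/-! the base sequence -/
noncomputable def g0 : ℕ → ℤ → ℝ
  | 0 => fun l => if l = 1 then 1/2 else if l = -1 then -1/2 else 0
  | k + 1 => fun l => (g0 k (l - 1) - g0 k (l + 1)) / 2

noncomputable def s0 (n : G) : ℂ := ((g0 0 n.1 * g0 0 n.2 : ℝ) : ℂ)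

def R : Finset G := {(1,1), (1,-1), (-1,1), (-1,-1)}

lemma s0_off {n : G} (hn : n ∉ R) : s0 n = 0 := by
  obtain ⟨l, j⟩ := n
  simp only [R, Finset.mem_insert, Finset.mem_singleton, Prod.mk.injEq, not_or] at hn
  simp only [s0, g0]
  split_ifs <;> simp_all

lemma A_s0 : A s0 := by
  refine summable_of_ne_finset_zero (s := R) fun n hn => ?_
  simp [s0_off hn]

lemma pw_s0 (k : ℕ) (l j : ℤ) : pw s0 k (l, j) = ((g0 k l * g0 k j : ℝ) : ℂ) := by
  induction k generalizing l j with
  | zero => rfl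
  | succ k ih =>
    have : pw s0 (k+1) (l, j) = ∑' q, s0 q * pw s0 k ((l, j) - q) := by
      simp only [pw, SDB.conv]
      rw [← (Equiv.subLeft (l, j)).tsum_eq]
      refine tsum_congr fun q => ?_
      simp [mul_comm]
    rw [this, tsum_eq_sum (s := R) (fun q hq => by simp [s0_off hq])]
    rw [R, Finset.sum_insert (by simp), Finset.sum_insert (by simp), Finset.sum_insert (by simp),
      Finset.sum_singleton]
    simp only [Prod.mk_sub_mk, ih, s0, g0]
    push_cast
    norm_num
    ring

lemma g0_supp (k : ℕ) (l : ℤ) (h : (k : ℤ) + 1 < |l|) : g0 k l = 0 := by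
  induction k generalizing l with
  | zero =>
    simp only [g0]
    have h1 : l ≠ 1 := by rintro rfl; simp at h
    have h2 : l ≠ -1 := by rintro rfl; simp at h
    simp [h1, h2]
  | succ k ih =>
    simp only [g0]
    push_cast at h
    rw [ih (l - 1) (by grind), ih (l + 1) (by grind)]
    simp

lemma g0_sign (k : ℕ) (r : ℤ) (h0 : 0 ≤ r) (h1 : r ≤ k + 1) :
    0 < (-1 : ℝ) ^ r * g0 k (k + 1 - 2 * r) := by
  induction k generalizing r with
  | zero =>
    have : r = 0 ∨ r = 1 := by simp at h1; omega
    rcases this with rfl | rfl <;> norm_num [g0]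
  | succ k ih =>
    simp only [g0]
    push_cast at h1 ⊢
    have hz : ∀ r : ℤ, 0 ≤ r → r ≤ k + 1 → 0 < (-1 : ℝ) ^ r * g0 k (k + 1 - 2 * r) := ih
    have e1 : (k : ℤ) + 1 + 1 - 2 * r - 1 = k + 1 - 2 * r := by ring
    have e2 : (k : ℤ) + 1 + 1 - 2 * r + 1 = k + 1 - 2 * (r - 1) := by ring
    rw [e1, e2]
    have e3 : (-1 : ℝ) ^ r = - (-1) ^ (r - 1) := by
      rw [zpow_sub₀ (by norm_num), zpow_one, div_neg, div_one, neg_neg]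
    have key : (-1 : ℝ) ^ r * ((g0 k (k + 1 - 2 * r) - g0 k (k + 1 - 2 * (r - 1))) / 2)
      = ((-1 : ℝ) ^ r * g0 k (k + 1 - 2 * r) + (-1 : ℝ) ^ (r-1) * g0 k (k + 1 - 2 * (r-1))) / 2 := by
      rw [e3]; ring
    rw [key]
    rcases eq_or_lt_of_le h0 with rfl | hpos
    · have := hz 0 le_rfl (by omega)
      have z : g0 k (k + 1 - 2 * (0 - 1)) = 0 := g0_supp k _ (by rw [abs_of_nonneg] <;> omega)
      rw [z, mul_zero ((-1:ℝ) ^ _), add_zero]; exact half_pos this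
    · have a := hz (r - 1) (by omega) (by omega)
      rcases eq_or_lt_of_le h1 with rfl | hlt
      · have z : g0 k (k + 1 - 2 * ((k:ℤ) + 1 + 1)) = 0 :=
          g0_supp k _ (by rw [abs_of_nonpos] <;> omega)
        rw [z, mul_zero ((-1:ℝ) ^ _)]; linarith
      · have b := hz r h0 (by omega)
        linarith

lemma g0_ne (p : ℕ) : g0 (2 * p) 1 ≠ 0 := by
  have := g0_sign (2 * p) p (by positivity) (by push_cast; omega)
  push_cast at this
  rw [show (2 * (p:ℤ) + 1 - 2 * p) = 1 by ring] at this
  intro h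
  rw [h] at this; simp at this

lemma g0_odd (l : ℤ) : g0 0 (-l) = - g0 0 l := by
  simp only [g0]
  by_cases h1 : l = 1
  · subst h1; norm_num
  · by_cases h2 : l = -1
    · subst h2; norm_num
    · have h3 : -l ≠ 1 := by omega
      have h4 : -l ≠ -1 := by omega
      simp [h1, h2, h3, h4]

lemma Sy_s0 : Sy (-1) s0 where
  conj l j := by simp [s0, g0_odd]
  odd l j := by simp [s0, g0_odd]
  par l j := by
    by_cases h1 : l = 1
    · subst h1; norm_num
    · by_cases h2 : l = -1
      · subst h2; norm_num
      · simp [s0, g0, h1, h2]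

end SDB
namespace SDB
open Complex

noncomputable def sz (n : G) : ℝ := 1 + |(n.1:ℝ)| + |(n.2:ℝ)|

lemma sz_pos (n : G) : 1 ≤ sz n := by
  unfold sz; have := abs_nonneg (n.1:ℝ); have := abs_nonneg (n.2:ℝ); linarith

def RD (f : G → ℂ) : Prop := ∀ k : ℕ, Summable fun n => ‖f n‖ * sz n ^ k

lemma poly_bound (k : ℕ) : ∃ C : ℝ, ∀ n : G, sz n ^ k ≤ C * W n := by
  obtain ⟨C, hC⟩ := (tendsto_pow_const_div_const_pow_of_one_lt k
    (show (1:ℝ) < 2 by norm_num)).bddAbove_range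
  refine ⟨C * 2, fun n => ?_⟩
  have h := hC ⟨n.1.natAbs + n.2.natAbs + 1, rfl⟩
  simp only at h
  rw [div_le_iff₀ (by positivity)] at h
  have e : sz n = ((n.1.natAbs + n.2.natAbs + 1 : ℕ) : ℝ) := by
    unfold sz; push_cast [Nat.cast_natAbs]; ring
  rw [e, W]
  calc _ ≤ _ := h
    _ = _ := by ring

lemma A.RD {f : G → ℂ} (hf : A f) : RD f := fun k => by
  obtain ⟨C, hC⟩ := poly_bound k
  refine Summable.of_nonneg_of_le (fun n => mul_nonneg (norm_nonneg _)
    (pow_nonneg (by linarith [sz_pos n]) _)) (fun n => ?_) (Summable.mul_left C hf)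
  calc ‖f n‖ * sz n ^ k ≤ ‖f n‖ * (C * W n) := mul_le_mul_of_nonneg_left (hC n) (norm_nonneg _)
    _ = _ := by ring

lemma RD.mul {f g : G → ℂ} (hf : SDB.RD f) (h : ∀ n, ‖g n‖ ≤ sz n * ‖f n‖) : SDB.RD g := fun k => by
  refine Summable.of_nonneg_of_le (fun n => mul_nonneg (norm_nonneg _)
    (pow_nonneg (by linarith [sz_pos n]) _)) (fun n => ?_) (hf (k + 1))
  calc ‖g n‖ * sz n ^ k ≤ (sz n * ‖f n‖) * sz n ^ k :=
        mul_le_mul_of_nonneg_right (h n) (pow_nonneg (by linarith [sz_pos n]) _)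
    _ = _ := by ring

noncomputable def dt (f : G → ℂ) (n : G) : ℂ := I * n.1 * f n
noncomputable def dx (f : G → ℂ) (n : G) : ℂ := I * n.2 * f n

lemma RD.dt {f : G → ℂ} (hf : SDB.RD f) : SDB.RD (dt f) := hf.mul fun n => by
  have h1 := abs_nonneg (n.2:ℝ)
  simp only [SDB.dt, norm_mul, norm_I, one_mul, Complex.norm_intCast]
  exact mul_le_mul_of_nonneg_right (by unfold sz; linarith) (norm_nonneg _)

lemma RD.dx {f : G → ℂ} (hf : SDB.RD f) : SDB.RD (dx f) := hf.mul fun n => by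
  have h1 := abs_nonneg (n.1:ℝ)
  simp only [SDB.dx, norm_mul, norm_I, one_mul, Complex.norm_intCast]
  exact mul_le_mul_of_nonneg_right (by unfold sz; linarith) (norm_nonneg _)

noncomputable def ex (n : G) (t x : ℝ) : ℂ := exp (((n.1 * t + n.2 * x : ℝ) : ℂ) * I)

lemma norm_ex (n : G) (t x : ℝ) : ‖ex n t x‖ = 1 := norm_exp_ofReal_mul_I _

noncomputable def ev (f : G → ℂ) (t x : ℝ) : ℂ := ∑' n, f n * ex n t x

lemma RD.sn {f : G → ℂ} (hf : SDB.RD f) : Summable fun n => ‖f n‖ := by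
  simpa using hf 0

lemma RD.summ {f : G → ℂ} (hf : SDB.RD f) (t x : ℝ) : Summable fun n => f n * ex n t x :=
  Summable.of_norm_bounded (g := fun n => ‖f n‖) hf.sn fun n => by
    rw [norm_mul, norm_ex, mul_one]

open ContinuousLinearMap in
lemma ev_hasFDerivAt {f : G → ℂ} (hf : RD f) (q : ℝ × ℝ) :
    HasFDerivAt (fun q : ℝ × ℝ => ev f q.1 q.2)
      ((smulRightL ℝ (ℝ × ℝ) ℂ (fst ℝ ℝ ℝ)) (ev (dt f) q.1 q.2) +
       (smulRightL ℝ (ℝ × ℝ) ℂ (snd ℝ ℝ ℝ)) (ev (dx f) q.1 q.2)) q := by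
  have e : ((smulRightL ℝ (ℝ × ℝ) ℂ (fst ℝ ℝ ℝ)) (ev (dt f) q.1 q.2) +
       (smulRightL ℝ (ℝ × ℝ) ℂ (snd ℝ ℝ ℝ)) (ev (dx f) q.1 q.2)) =
     ∑' n, ((smulRightL ℝ (ℝ × ℝ) ℂ (fst ℝ ℝ ℝ)) (dt f n * ex n q.1 q.2) +
       (smulRightL ℝ (ℝ × ℝ) ℂ (snd ℝ ℝ ℝ)) (dx f n * ex n q.1 q.2)) := by
    unfold ev
    rw [ContinuousLinearMap.map_tsum _ (hf.dt.summ _ _),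
      ContinuousLinearMap.map_tsum _ (hf.dx.summ _ _), ← Summable.tsum_add]
    · exact ContinuousLinearMap.summable _ (hf.dt.summ _ _)
    · exact ContinuousLinearMap.summable _ (hf.dx.summ _ _)
  rw [e]
  unfold ev
  refine hasFDerivAt_tsum (u := fun n => ‖f n‖ * sz n ^ 1) (x₀ := ((0:ℝ), (0:ℝ)))
    (f := fun n (q : ℝ × ℝ) => f n * ex n q.1 q.2)
    (f' := fun n (q : ℝ × ℝ) => ((smulRightL ℝ (ℝ × ℝ) ℂ (fst ℝ ℝ ℝ)) (dt f n * ex n q.1 q.2) +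
       (smulRightL ℝ (ℝ × ℝ) ℂ (snd ℝ ℝ ℝ)) (dx f n * ex n q.1 q.2))) (hf 1) ?_ ?_ (hf.summ 0 0) q
  · intro n q
    have h1 : HasFDerivAt (fun q : ℝ × ℝ => (n.1 * q.1 + n.2 * q.2 : ℝ))
        ((n.1:ℝ) • fst ℝ ℝ ℝ + (n.2:ℝ) • snd ℝ ℝ ℝ) q :=
      (hasFDerivAt_fst.const_mul _).add (hasFDerivAt_snd.const_mul _)
    have h2 := (Complex.ofRealCLM.hasFDerivAt.comp q h1).mul_const I
    have h3 := (h2.cexp).const_mul (f n)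
    refine h3.congr_fderiv ?_
    ext <;> simp [dt, dx, ex] <;> ring
  · intro n q
    refine opNorm_le_bound _ (mul_nonneg (norm_nonneg _) (pow_nonneg (by linarith [sz_pos n]) _)) ?_
    intro v
    simp only [add_apply, smulRightL_apply_apply, smulRight_apply, coe_fst', coe_snd', dt, dx]
    have e2 : v.1 • (I * n.1 * f n * ex n q.1 q.2) + v.2 • (I * n.2 * f n * ex n q.1 q.2)
      = ((v.1 * n.1 + v.2 * n.2 : ℝ) : ℂ) * (I * (f n * ex n q.1 q.2)) := by
      simp only [real_smul]; push_cast; ring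
    rw [e2, norm_mul, norm_mul, norm_mul, norm_ex, norm_I, Complex.norm_real, Real.norm_eq_abs]
    have h1 : |v.1 * n.1 + v.2 * n.2| ≤ sz n * ‖v‖ := by
      have a1 : |v.1| ≤ ‖v‖ := norm_fst_le v
      have a2 : |v.2| ≤ ‖v‖ := norm_snd_le v
      calc |v.1 * n.1 + v.2 * n.2| ≤ |v.1| * |(n.1:ℝ)| + |v.2| * |(n.2:ℝ)| := by
            rw [← abs_mul, ← abs_mul]; exact abs_add_le _ _
        _ ≤ ‖v‖ * |(n.1:ℝ)| + ‖v‖ * |(n.2:ℝ)| := by gcongr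
        _ ≤ _ := by unfold sz; nlinarith [norm_nonneg v]
    calc _ ≤ (sz n * ‖v‖) * (1 * (‖f n‖ * 1)) := by gcongr
      _ = _ := by ring

lemma ev_hasDerivAt_t {f : G → ℂ} (hf : RD f) (t x : ℝ) :
    HasDerivAt (fun t => ev f t x) (ev (dt f) t x) t := by
  have h := (ev_hasFDerivAt hf (t, x)).comp_hasDerivAt t
    ((hasDerivAt_id t).prodMk (hasDerivAt_const t x))
  simpa [Function.comp_def] using h

lemma ev_hasDerivAt_x {f : G → ℂ} (hf : RD f) (t x : ℝ) :
    HasDerivAt (fun x => ev f t x) (ev (dx f) t x) x := by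
  have h := (ev_hasFDerivAt hf (t, x)).comp_hasDerivAt x
    ((hasDerivAt_const x t).prodMk (hasDerivAt_id x))
  simpa [Function.comp_def] using h

lemma ev_contDiff (k : ℕ) : ∀ {f : G → ℂ}, RD f →
    ContDiff ℝ k (fun q : ℝ × ℝ => ev f q.1 q.2) := by
  induction k with
  | zero =>
    intro f hf
    rw [Nat.cast_zero, contDiff_zero]
    exact continuous_iff_continuousAt.2 fun q => (ev_hasFDerivAt hf q).continuousAt
  | succ k ih =>
    intro f hf
    rw [Nat.cast_succ, contDiff_succ_iff_hasFDerivAt]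
    refine ⟨_, ?_, fun q => ev_hasFDerivAt hf q⟩
    exact ((ContinuousLinearMap.contDiff _).comp (ih hf.dt)).add
      ((ContinuousLinearMap.contDiff _).comp (ih hf.dx))

lemma ev_conv {f g : G → ℂ} (hf : A f) (hg : A g) (t x : ℝ) :
    ev (conv f g) t x = ev f t x * ev g t x := by
  have h0 : Summable fun q : G × G => (f q.1 * ex q.1 t x) * (g q.2 * ex q.2 t x) := by
    refine summable_mul_of_summable_norm (f := fun n => f n * ex n t x)
      (g := fun n => g n * ex n t x) ?_ ?_
    · simpa [norm_mul, norm_ex] using hf.summable_norm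
    · simpa [norm_mul, norm_ex] using hg.summable_norm
  unfold ev
  rw [Summable.tsum_mul_tsum (hf.RD.summ t x) (hg.RD.summ t x) h0]
  rw [← shear.tsum_eq (fun q : G × G => (f q.1 * ex q.1 t x) * (g q.2 * ex q.2 t x))]
  have h1 := (shear.summable_iff
    (f := fun q : G × G => (f q.1 * ex q.1 t x) * (g q.2 * ex q.2 t x))).2 h0
  simp only [Function.comp_def] at h1
  rw [Summable.tsum_prod h1]
  refine tsum_congr fun n => ?_
  rw [conv, ← tsum_mul_right]
  refine tsum_congr fun k => ?_
  simp only [shear, Equiv.coe_fn_mk]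
  have : ex n t x = ex k t x * ex (n - k) t x := by
    unfold ex
    rw [← Complex.exp_add]
    congr 1
    simp only [Prod.fst_sub, Prod.snd_sub]
    push_cast
    ring
  rw [this]; ring

lemma ev_pw {f : G → ℂ} (hf : A f) (k : ℕ) (t x : ℝ) :
    ev (pw f k) t x = ev f t x ^ (k + 1) := by
  induction k with
  | zero => simp [pw]
  | succ k ih => rw [pw, ev_conv (hf.pw k) hf, ih]; ring

lemma ev_const_mul (f : G → ℂ) (a : ℂ) (t x : ℝ) :
    ev (fun n => a * f n) t x = a * ev f t x := by
  unfold ev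
  rw [← tsum_mul_left]
  exact tsum_congr fun n => by ring

lemma ev_period (f : G → ℂ) (t x : ℝ) : ev f (t + 2 * Real.pi) x = ev f t x := by
  unfold ev
  refine tsum_congr fun n => ?_
  congr 1
  unfold ex
  rw [Complex.exp_eq_exp_iff_exists_int]
  exact ⟨n.1, by push_cast; ring⟩

lemma ev_period_x (f : G → ℂ) (t x : ℝ) : ev f t (x + 2 * Real.pi) = ev f t x := by
  unfold ev
  refine tsum_congr fun n => ?_
  congr 1
  unfold ex
  rw [Complex.exp_eq_exp_iff_exists_int]
  exact ⟨n.2, by push_cast; ring⟩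

lemma ev_odd {f : G → ℂ} (h : ∀ l j : ℤ, f (l, -j) = - f (l, j)) (t x : ℝ) :
    ev f t (-x) = - ev f t x := by
  unfold ev
  rw [← tsum_neg, ← reflx.tsum_eq]
  refine tsum_congr fun n => ?_
  obtain ⟨l, j⟩ := n
  simp only [reflx, Equiv.coe_fn_mk, h, ex]
  push_cast
  ring_nf

lemma ev_real {f : G → ℂ} (h : ∀ l j : ℤ, f (-l, -j) = (starRingEnd ℂ) (f (l, j))) (t x : ℝ) :
    (starRingEnd ℂ) (ev f t x) = ev f t x := by
  unfold ev
  rw [Complex.conj_tsum, ← (Equiv.neg G).tsum_eq]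
  refine tsum_congr fun n => ?_
  obtain ⟨l, j⟩ := n
  simp only [Equiv.neg_apply, Prod.neg_mk, h, ex, map_mul, ← Complex.exp_conj, conj_conj, conj_ofReal,
    conj_I]
  push_cast
  ring_nf

lemma ev_bc {f : G → ℂ} (h : ∀ l j : ℤ, f (l, -j) = - f (l, j)) (t : ℝ) :
    ev f t 0 = 0 ∧ ev f t Real.pi = 0 := by
  constructor
  · have := ev_odd h t 0
    rw [neg_zero] at this
    linear_combination this / 2
  · have h1 := ev_odd h t Real.pi
    have h2 := ev_period_x f t (-Real.pi)
    rw [show -Real.pi + 2 * Real.pi = Real.pi by ring] at h2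
    linear_combination h1 / 2 + h2 / 2

lemma ev_norm_le {f : G → ℂ} (hf : A f) (t x : ℝ) : ‖ev f t x‖ ≤ N f := by
  refine le_trans ?_ (tsum_norm_le_N hf)
  have := norm_tsum_le_tsum_norm (f := fun n => f n * ex n t x) (hf.RD.summ t x).norm
  simpa only [ev, norm_mul, norm_ex, mul_one] using this

lemma ev_add {f g : G → ℂ} (hf : RD f) (hg : RD g) (t x : ℝ) :
    ev (f + g) t x = ev f t x + ev g t x := by
  unfold ev
  rw [← (hf.summ t x).tsum_add (hg.summ t x)]
  exact tsum_congr fun n => by simp [add_mul]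

/-- antiderivative in t -/
noncomputable def it (f : G → ℂ) (n : G) : ℂ := f n / (I * n.1)

lemma it_norm (f : G → ℂ) (n : G) : ‖it f n‖ ≤ 1 * ‖f n‖ := by
  unfold it
  rw [norm_div, norm_mul, norm_I, one_mul, Complex.norm_intCast, one_mul]
  by_cases h : n.1 = 0
  · simp [h]
  · have : (1:ℝ) ≤ |(n.1:ℝ)| := by exact_mod_cast Int.one_le_abs h
    exact div_le_self (norm_nonneg _) this

lemma A.it {f : G → ℂ} (hf : A f) : A (it f) := hf.mono (it_norm f)

lemma ev_it_s0 (t x : ℝ) : ev (it s0) t x = ((Real.cos t * Real.sin x : ℝ) : ℂ) := by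
  unfold ev
  rw [tsum_eq_sum (s := R) (fun q hq => by simp [it, s0_off hq])]
  rw [R, Finset.sum_insert (by simp), Finset.sum_insert (by simp), Finset.sum_insert (by simp),
      Finset.sum_singleton]
  have h1 : ∀ a b : ℝ, exp (((a + b : ℝ) : ℂ) * I) = exp (a * I) * exp (b * I) := by
    intro a b; rw [← Complex.exp_add]; push_cast; ring_nf
  simp only [it, s0, g0, ex, h1]
  push_cast
  have e1 : cos (t:ℂ) = (exp (t * I) + exp (-t * I)) / 2 := rfl
  have e2 : sin (x:ℂ) = (exp (-x * I) - exp (x * I)) * I / 2 := rfl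
  rw [e1, e2]
  norm_num
  have hI : (I:ℂ) * I = -1 := I_mul_I
  field_simp
  ring_nf
  simp only [I_sq]
  ring
end SDB
namespace SDB
open Complex

noncomputable def Dn (m : ℝ) (n : G) : ℝ := (n.2:ℝ)^2 + m - (1 + m) * (n.1:ℝ)^2

noncomputable def sym (m ν : ℝ) (φ : ℂ) (n : G) : ℂ :=
  ((Dn m n - ν * (4 * φ.im) * (n.1:ℝ)^2 : ℝ) : ℂ) + ((ν * (4 * φ.re) * n.1 * (n.2:ℝ)^2 : ℝ) : ℂ) * I

structure Om (n : G) : Prop where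
  odd : Odd n.1
  ne : n.2 ≠ 0
  nR : n ∉ R

lemma sym_re (m ν : ℝ) (φ : ℂ) (n : G) :
    (sym m ν φ n).re = Dn m n - ν * (4 * φ.im) * (n.1:ℝ)^2 := by
  simp only [sym, add_re, mul_re, ofReal_re, ofReal_im, I_re, I_im]; ring

lemma sym_im (m ν : ℝ) (φ : ℂ) (n : G) :
    (sym m ν φ n).im = ν * (4 * φ.re) * n.1 * (n.2:ℝ)^2 := by
  simp only [sym, add_im, mul_im, ofReal_re, ofReal_im, I_re, I_im]; ring

lemma Om.l_ge {n : G} (h : Om n) : (1:ℝ) ≤ |(n.1:ℝ)| := by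
  have : n.1 ≠ 0 := by intro h0; have := h.odd; rw [h0] at this; exact absurd this (by decide)
  exact_mod_cast Int.one_le_abs this

lemma Om.j_ge {n : G} (h : Om n) : (1:ℝ) ≤ (n.2:ℝ)^2 := by
  have : (1:ℝ) ≤ |(n.2:ℝ)| := by exact_mod_cast Int.one_le_abs h.ne
  rw [← sq_abs]; nlinarith

lemma sym_B3 {m ν q0 : ℝ} {φ : ℂ} (n : G) (hν : 0 < ν) (hq : q0 ≤ 4 * φ.re)
    (hq0 : 0 < q0) : q0 * (ν * |(n.1:ℝ)| * (n.2:ℝ)^2) ≤ ‖sym m ν φ n‖ := by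
  refine le_trans ?_ (abs_im_le_norm _)
  rw [sym_im, abs_mul, abs_mul, abs_of_nonneg (sq_nonneg (n.2:ℝ)),
    abs_of_nonneg (by nlinarith : 0 ≤ ν * (4 * φ.re))]
  have : 0 ≤ ν * |(n.1:ℝ)| * (n.2:ℝ)^2 := by positivity
  nlinarith

lemma sym_Bc {m ν β0 : ℝ} {φ : ℂ} {n : G} (hm : 0 < m) (hn : Om n) (hν : 0 < ν)
    (hβ : |4 * φ.im| ≤ β0) (hνβ : ν * β0 ≤ 1/4) (hlj : 4 * (n.2:ℝ)^2 < (n.1:ℝ)^2) :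
    (n.1:ℝ)^2 ≤ 2 * ‖sym m ν φ n‖ := by
  have h1 := (abs_le.1 ((abs_re_le_norm (sym m ν φ n)))).1
  rw [sym_re] at h1
  have h2 := hn.l_ge
  have h3 : 1 ≤ (n.1:ℝ)^2 := by rw [← sq_abs]; nlinarith
  have h4 : -(1/4) ≤ ν * (4 * φ.im) := by
    have := (abs_le.1 hβ).1
    nlinarith
  have h5 : Dn m n ≤ -(3/4) * (n.1:ℝ)^2 := by unfold Dn; nlinarith
  nlinarith

lemma sym_B2 {m ν q0 β0 : ℝ} {φ : ℂ} {n : G} (hm : 0 < m) (hn : Om n) (hν : 0 < ν) (hν1 : ν ≤ 1)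
    (hq : q0 ≤ 4 * φ.re) (hq0 : 0 < q0)
    (hβ : |4 * φ.im| ≤ β0) (hνβ : ν * β0 ≤ 1/4) :
    ν * (n.1:ℝ)^2 ≤ (4 / q0 + 2) * ‖sym m ν φ n‖ := by
  have hN := norm_nonneg (sym m ν φ n)
  have h0 : 0 ≤ 4 / q0 * ‖sym m ν φ n‖ := by positivity
  by_cases hlj : 4 * (n.2:ℝ)^2 < (n.1:ℝ)^2
  · have h := sym_Bc hm hn hν hβ hνβ hlj
    nlinarith [sq_nonneg (n.1:ℝ)]
  · push Not at hlj
    have h := sym_B3 (m := m) n hν hq hq0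
    have h2 : ν * |(n.1:ℝ)| * (n.2:ℝ)^2 ≤ ‖sym m ν φ n‖ / q0 := by
      rw [le_div_iff₀ hq0]; linarith
    have h3 : ν * (n.2:ℝ)^2 ≤ ν * |(n.1:ℝ)| * (n.2:ℝ)^2 := by
      have := hn.l_ge
      have : 0 ≤ ν * (n.2:ℝ)^2 := by positivity
      nlinarith
    have h4 : 4 / q0 * ‖sym m ν φ n‖ = 4 * (‖sym m ν φ n‖ / q0) := by ring
    nlinarith

lemma Dn_ne {m : ℝ} (hmi : Irrational m) {n : G} (hn : Om n) : Dn m n ≠ 0 := by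
  intro h
  obtain ⟨l, j⟩ := n
  have hR := hn.nR
  simp only [Dn] at h
  by_cases hl : l ^ 2 = 1
  · have hl' : (l:ℝ)^2 = 1 := by exact_mod_cast hl
    rw [hl'] at h
    have hj : (j:ℝ)^2 = 1 := by linarith
    have hj' : j ^ 2 = 1 := by exact_mod_cast hj
    apply hR
    have q : ∀ a : ℤ, a ^ 2 = 1 → a = 1 ∨ a = -1 := fun a ha =>
      sq_eq_sq_iff_eq_or_eq_neg.1 (by rw [ha]; norm_num)
    rcases q l hl with h1 | h1 <;> rcases q j hj' with h2 | h2 <;> simp [R, h1, h2]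
  · have hl' : ((l:ℝ)^2 - 1) ≠ 0 := by
      intro h0; apply hl
      have : (l:ℝ)^2 = 1 := by linarith
      exact_mod_cast this
    apply hmi
    refine ⟨((j:ℚ)^2 - (l:ℚ)^2) / ((l:ℚ)^2 - 1), ?_⟩
    push_cast
    rw [div_eq_iff hl']
    linarith

lemma fin_min {g : G → ℝ} {P : G → Prop} (h : ∀ n, P n → 0 < g n) (F : Finset G) :
    ∃ d > 0, ∀ n ∈ F, P n → d ≤ g n := by
  classical
  induction F using Finset.induction_on with
  | empty => exact ⟨1, one_pos, by simp⟩
  | insert a s _ ih =>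
    obtain ⟨d, hd, hs⟩ := ih
    by_cases hP : P a
    · refine ⟨min d (g a), lt_min hd (h a hP), fun n hn hPn => ?_⟩
      rcases Finset.mem_insert.1 hn with rfl | hn
      · exact min_le_right _ _
      · exact (min_le_left _ _).trans (hs n hn hPn)
    · refine ⟨d, hd, fun n hn hPn => ?_⟩
      rcases Finset.mem_insert.1 hn with rfl | hn
      · exact absurd hPn hP
      · exact hs n hn hPn

lemma sym_fin {m : ℝ} (hm : 0 < m) (hmi : Irrational m) (J : ℕ) {β0 : ℝ} (hβ0 : 0 ≤ β0) :
    ∃ C > 0, ∃ ν1 > 0, ∀ (ν : ℝ) (φ : ℂ) (n : G), 0 < ν → ν ≤ ν1 → |4 * φ.im| ≤ β0 → Om n →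
      |n.2| ≤ J → |(n.1:ℝ)| ≤ C * ‖sym m ν φ n‖ := by
  obtain ⟨d, hd, hF⟩ := fin_min (g := fun n => |Dn m n|) (P := Om)
    (fun n hn => abs_pos.2 (Dn_ne hmi hn))
    (Finset.Icc (-(2 * (J:ℤ))) (2 * J) ×ˢ Finset.Icc (-(J:ℤ)) J)
  refine ⟨2 + 4 * J / d, by positivity,
    min (1 / (4 * (β0 + 1))) (d / (2 * ((β0 + 1) * (4 * (J + 1)^2)))), by positivity, ?_⟩
  intro ν φ n hν hν1 hβ hn hj
  have hν2 := hν1.trans (min_le_left _ _)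
  have hν3 := hν1.trans (min_le_right _ _)
  rw [le_div_iff₀ (by positivity)] at hν2 hν3
  have hN := norm_nonneg (sym m ν φ n)
  have hl := hn.l_ge
  by_cases hlj : 4 * (n.2:ℝ)^2 < (n.1:ℝ)^2
  · have h := sym_Bc hm hn hν hβ (by nlinarith) hlj
    rw [← sq_abs] at h
    have : 0 ≤ 4 * J / d * ‖sym m ν φ n‖ := by positivity
    nlinarith
  · push Not at hlj
    have hjr : |(n.2:ℝ)| ≤ J := by exact_mod_cast hj
    have hlr : |(n.1:ℝ)| ≤ 2 * J := by
      refine abs_le_of_sq_le_sq ?_ (by positivity)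
      rw [← sq_abs (n.2:ℝ)] at hlj
      nlinarith [abs_nonneg (n.2:ℝ)]
    have hlz : |n.1| ≤ 2 * J := by exact_mod_cast hlr
    have hmem : n ∈ (Finset.Icc (-(2 * (J:ℤ))) (2 * J) ×ˢ Finset.Icc (-(J:ℤ)) J) := by
      rw [Finset.mem_product, Finset.mem_Icc, Finset.mem_Icc]
      exact ⟨abs_le.1 hlz, abs_le.1 hj⟩
    have hD := hF n hmem hn
    have h1 : |ν * (4 * φ.im) * (n.1:ℝ)^2| ≤ d / 2 := by
      rw [abs_mul, abs_mul, abs_of_pos hν, abs_of_nonneg (sq_nonneg (n.1:ℝ))]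
      have a1 : (n.1:ℝ)^2 ≤ 4 * (J+1)^2 := by rw [← sq_abs]; nlinarith
      calc ν * |4 * φ.im| * (n.1:ℝ)^2 ≤ ν * (β0 + 1) * (4 * (J+1)^2) := by
            gcongr; linarith
        _ ≤ d / 2 := by linarith
    have h2 := abs_re_le_norm (sym m ν φ n)
    rw [sym_re] at h2
    have h3 := abs_sub_abs_le_abs_sub (Dn m n) (ν * (4 * φ.im) * (n.1:ℝ)^2)
    have h4 : d / 2 ≤ ‖sym m ν φ n‖ := by linarith
    calc |(n.1:ℝ)| ≤ 2 * J := hlr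
      _ = 4 * J / d * (d / 2) := by field_simp; ring
      _ ≤ 4 * J / d * ‖sym m ν φ n‖ := by gcongr
      _ ≤ _ := by nlinarith

lemma sym_B1 {m : ℝ} (hm : 0 < m) (hmi : Irrational m) {q0 β0 ε : ℝ} (hq0 : 0 < q0) (hβ0 : 0 ≤ β0)
    (hε : 0 < ε) : ∃ ν1 > 0, ∀ (ν : ℝ) (φ : ℂ) (n : G), 0 < ν → ν ≤ ν1 → q0 ≤ 4 * φ.re →
      |4 * φ.im| ≤ β0 → Om n → ν * |(n.1:ℝ)| ≤ ε * ‖sym m ν φ n‖ := by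
  obtain ⟨J, hJ⟩ := exists_nat_gt (1 / (q0 * ε))
  obtain ⟨C, hC, ν1, hν1, h⟩ := sym_fin hm hmi J hβ0
  refine ⟨min ν1 (ε / C), by positivity, ?_⟩
  intro ν φ n hν hνν hq hβ hn
  have hN := norm_nonneg (sym m ν φ n)
  by_cases hj : |n.2| ≤ J
  · have := h ν φ n hν (hνν.trans (min_le_left _ _)) hβ hn hj
    have h2 := hνν.trans (min_le_right _ _)
    rw [le_div_iff₀ hC] at h2
    calc ν * |(n.1:ℝ)| ≤ ν * (C * ‖sym m ν φ n‖) := by gcongr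
      _ = (ν * C) * ‖sym m ν φ n‖ := by ring
      _ ≤ _ := by gcongr
  · push Not at hj
    have hjr : (J:ℝ) < |(n.2:ℝ)| := by exact_mod_cast hj
    have hj1 : 1 ≤ |(n.2:ℝ)| := by exact_mod_cast Int.one_le_abs hn.ne
    have h3 := sym_B3 (m := m) n hν hq hq0
    have h4 : 1 ≤ q0 * ε * (n.2:ℝ)^2 := by
      rw [div_lt_iff₀ (by positivity)] at hJ
      rw [← sq_abs]
      have a : 1 ≤ |(n.2:ℝ)| * (q0 * ε) := hJ.le.trans (by gcongr)
      nlinarith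
    calc ν * |(n.1:ℝ)| ≤ ν * |(n.1:ℝ)| * (q0 * ε * (n.2:ℝ)^2) := le_mul_of_one_le_right (by positivity) h4
      _ = ε * (q0 * (ν * |(n.1:ℝ)| * (n.2:ℝ)^2)) := by ring
      _ ≤ _ := by gcongr

open Classical in
noncomputable def tau (m ν : ℝ) (φ : ℂ) (n : G) : ℂ :=
  if Om n then I * ν * n.1 / sym m ν φ n else 0

lemma tau_norm {m ν : ℝ} {φ : ℂ} {n : G} {e : ℝ} (he : 0 ≤ e) (hν : 0 < ν)
    (h : Om n → ν * |(n.1:ℝ)| ≤ e * ‖sym m ν φ n‖) : ‖tau m ν φ n‖ ≤ e := by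
  unfold tau
  split_ifs with hn
  · rw [norm_div, norm_mul, norm_mul, norm_I, one_mul, Complex.norm_real, Complex.norm_intCast,
      Real.norm_eq_abs, abs_of_pos hν]
    exact div_le_of_le_mul₀ (norm_nonneg _) he (h hn)
  · simpa using he

lemma tau_lip {m ε q0 β0 μ h1 h2 : ℝ} {φ1 φ2 : ℂ} {n : G} (hm : 0 < m) (hε : 0 ≤ ε)
    (hq0 : 0 < q0) (hβ0 : 0 ≤ β0) (hμ : 0 < μ)
    (hh1 : 1 ≤ h1) (hh2 : 1 ≤ h2) (hν1 : μ * h1 ≤ 1) (hν2 : μ * h2 ≤ 1)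
    (hq1 : q0 ≤ 4 * φ1.re) (hq2 : q0 ≤ 4 * φ2.re)
    (hb1 : |4 * φ1.im| ≤ β0) (hb2 : |4 * φ2.im| ≤ β0)
    (hb1' : μ * h1 * β0 ≤ 1/4) (hb2' : μ * h2 * β0 ≤ 1/4)
    (hB : Om n → (μ * h1) * |(n.1:ℝ)| ≤ ε * ‖sym m (μ * h1) φ1 n‖) :
    ‖tau m (μ * h1) φ1 n - tau m (μ * h2) φ2 n‖ ≤
      ε * ((1 + β0 * (4/q0 + 2)) + 8 * (4/q0+2)) * (|h1 - h2| + ‖φ1 - φ2‖) := by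
  have hK : 0 < 4/q0 + 2 := by positivity
  set K := 4/q0 + 2 with hKdef
  by_cases hn : Om n
  swap
  · simp only [tau, hn, if_false, sub_zero, norm_zero]; positivity
  simp only [tau, hn, if_true]
  have hB1 := hB hn
  set ν1 := μ * h1 with hν1d
  set ν2 := μ * h2 with hν2d
  have p1 : 0 < ν1 := by positivity
  have p2 : 0 < ν2 := by positivity
  set s1 := sym m ν1 φ1 n with hs1
  set s2 := sym m ν2 φ2 n with hs2
  have hl := hn.l_ge
  have hl2 : 1 ≤ (n.1:ℝ)^2 := by rw [← sq_abs]; nlinarith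
  have c1 : ν1 * (n.1:ℝ)^2 ≤ K * ‖s1‖ := sym_B2 hm hn p1 hν1 hq1 hq0 hb1 hb1'
  have c2 : ν2 * (n.1:ℝ)^2 ≤ K * ‖s2‖ := sym_B2 hm hn p2 hν2 hq2 hq0 hb2 hb2'
  have c3 : q0 * (ν2 * |(n.1:ℝ)| * (n.2:ℝ)^2) ≤ ‖s2‖ := sym_B3 n p2 hq2 hq0
  have n1 : 0 < ‖s1‖ := by
    have : 0 < K * ‖s1‖ := lt_of_lt_of_le (by positivity) c1
    exact pos_of_mul_pos_right this hK.le
  have n2 : 0 < ‖s2‖ := by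
    have : 0 < K * ‖s2‖ := lt_of_lt_of_le (by positivity) c2
    exact pos_of_mul_pos_right this hK.le
  have c3' : ν2 * |(n.1:ℝ)| * (n.2:ℝ)^2 ≤ K * ‖s2‖ := by
    have : ν2 * |(n.1:ℝ)| * (n.2:ℝ)^2 ≤ ‖s2‖ / q0 := by rw [le_div_iff₀ hq0]; linarith
    refine this.trans ?_
    rw [hKdef, div_eq_mul_inv, mul_comm]
    apply mul_le_mul_of_nonneg_right _ n2.le
    have : 4 / q0 = 4 * q0⁻¹ := by ring
    have : 0 < q0⁻¹ := by positivity
    linarith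
  have z1 : s1 ≠ 0 := norm_pos_iff.1 n1
  have z2 : s2 ≠ 0 := norm_pos_iff.1 n2
  have key : I * ν1 * n.1 / s1 - I * ν2 * n.1 / s2 =
      I * n.1 * (ν1 * s2 - ν2 * s1) / (s1 * s2) := by
    field_simp
  have num : (ν1 * s2 - ν2 * s1 : ℂ) = (((ν1 - ν2) * Dn m n : ℝ) : ℂ)
      + ((ν1 * (ν2 * ((4 * (φ1 - φ2).im) * (n.1:ℝ)^2)) : ℝ) : ℂ)
      - ((ν1 * (ν2 * ((4 * (φ1 - φ2).re) * n.1 * (n.2:ℝ)^2)) : ℝ) : ℂ) * I := by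
    simp only [hs1, hs2, sym, sub_im, sub_re]
    push_cast
    ring
  have hDb : |Dn m n| ≤ (1 + β0 * K) * ‖s2‖ := by
    have a := abs_re_le_norm s2
    rw [hs2, sym_re, ← hs2] at a
    have b := abs_sub_abs_le_abs_sub (Dn m n) (ν2 * (4 * φ2.im) * (n.1:ℝ)^2)
    have c : |ν2 * (4 * φ2.im) * (n.1:ℝ)^2| ≤ β0 * (K * ‖s2‖) := by
      rw [abs_mul, abs_mul, abs_of_pos p2, abs_of_nonneg (sq_nonneg (n.1:ℝ))]
      calc ν2 * |4 * φ2.im| * (n.1:ℝ)^2 = |4 * φ2.im| * (ν2 * (n.1:ℝ)^2) := by ring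
        _ ≤ _ := by gcongr
    nlinarith
  have hνd : |ν1 - ν2| ≤ ν1 * |h1 - h2| := by
    rw [hν1d, hν2d, ← mul_sub, abs_mul, abs_of_pos hμ]
    nlinarith [abs_nonneg (h1 - h2), mul_nonneg hμ.le (abs_nonneg (h1 - h2))]
  clear_value ν1 ν2
  have hφi : |(φ1 - φ2).im| ≤ ‖φ1 - φ2‖ := abs_im_le_norm _
  have hφr : |(φ1 - φ2).re| ≤ ‖φ1 - φ2‖ := abs_re_le_norm _
  have numb : ‖(ν1 * s2 - ν2 * s1 : ℂ)‖ ≤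
      ν1 * ‖s2‖ * (((1 + β0 * K) + 8 * K) * (|h1 - h2| + ‖φ1 - φ2‖)) := by
    rw [num]
    have t1 : ‖(((ν1 - ν2) * Dn m n : ℝ) : ℂ)‖ ≤ ν1 * |h1 - h2| * ((1 + β0 * K) * ‖s2‖) := by
      rw [Complex.norm_real, Real.norm_eq_abs, abs_mul]
      exact mul_le_mul hνd hDb (abs_nonneg _) (by positivity)
    have t2 : ‖((ν1 * (ν2 * ((4 * (φ1 - φ2).im) * (n.1:ℝ)^2)) : ℝ) : ℂ)‖ ≤
        ν1 * (4 * ‖φ1 - φ2‖ * (K * ‖s2‖)) := by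
      rw [Complex.norm_real, Real.norm_eq_abs, abs_mul, abs_mul, abs_mul, abs_mul, abs_of_pos p1,
        abs_of_pos p2, abs_of_nonneg (sq_nonneg (n.1:ℝ)), abs_of_pos (by norm_num : (0:ℝ) < 4)]
      calc ν1 * (ν2 * (4 * |(φ1 - φ2).im| * (n.1:ℝ)^2))
          = ν1 * (4 * |(φ1 - φ2).im| * (ν2 * (n.1:ℝ)^2)) := by ring
        _ ≤ _ := by gcongr
    have t3 : ‖((ν1 * (ν2 * ((4 * (φ1 - φ2).re) * n.1 * (n.2:ℝ)^2)) : ℝ) : ℂ) * I‖ ≤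
        ν1 * (4 * ‖φ1 - φ2‖ * (K * ‖s2‖)) := by
      rw [norm_mul, norm_I, mul_one, Complex.norm_real, Real.norm_eq_abs, abs_mul, abs_mul, abs_mul,
        abs_mul, abs_mul, abs_of_pos p1,
        abs_of_pos p2, abs_of_nonneg (sq_nonneg (n.2:ℝ)), abs_of_pos (by norm_num : (0:ℝ) < 4)]
      calc ν1 * (ν2 * (4 * |(φ1 - φ2).re| * |(n.1:ℝ)| * (n.2:ℝ)^2))
          = ν1 * (4 * |(φ1 - φ2).re| * (ν2 * |(n.1:ℝ)| * (n.2:ℝ)^2)) := by ring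
        _ ≤ _ := by gcongr
    refine (norm_sub_le _ _).trans ((add_le_add (norm_add_le _ _) le_rfl).trans ?_)
    have x1 : 0 ≤ ν1 * ‖s2‖ * (8 * K) * |h1 - h2| := by positivity
    have x2 : 0 ≤ ν1 * ‖s2‖ * (1 + β0 * K) * ‖φ1 - φ2‖ := by positivity
    nlinarith
  rw [key, norm_div, norm_mul, norm_mul, norm_mul, norm_I, one_mul, Complex.norm_intCast,
    div_le_iff₀ (by positivity)]
  set Y := ((1 + β0 * K) + 8 * K) * (|h1 - h2| + ‖φ1 - φ2‖) with hY
  have hY0 : 0 ≤ Y := by positivity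
  calc |(n.1:ℝ)| * ‖(ν1 * s2 - ν2 * s1 : ℂ)‖ ≤ |(n.1:ℝ)| * (ν1 * ‖s2‖ * Y) := by gcongr
    _ = (ν1 * |(n.1:ℝ)|) * (‖s2‖ * Y) := by ring
    _ ≤ (ε * ‖s1‖) * (‖s2‖ * Y) := by gcongr
    _ = _ := by rw [hY]; ring

end SDB
namespace SDB
open Complex

noncomputable abbrev E := lp (fun _ : G => ℂ) 1

noncomputable def raw (c : E) (n : G) : ℂ := c n / (W n : ℂ)

lemma raw_mul (c : E) (n : G) : ‖raw c n‖ * W n = ‖c n‖ := by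
  unfold raw
  rw [norm_div, Complex.norm_real, Real.norm_eq_abs, abs_of_pos (W_pos n),
    div_mul_cancel₀ _ (W_pos n).ne']

lemma A_raw (c : E) : A (raw c) := by
  have h := (lp.memℓp c).summable (by simp)
  simpa [A, raw_mul] using h

lemma norm_raw (c : E) : ‖c‖ = N (raw c) := by
  rw [lp.norm_eq_tsum_rpow (by simp)]
  simp [N, raw_mul]

lemma raw_sub (c d : E) : raw (c - d) = raw c - raw d := by
  ext n; simp [raw, sub_div]

lemma dist_raw (c d : E) : dist c d = N (raw c - raw d) := by
  rw [dist_eq_norm, norm_raw, raw_sub]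

open Classical in
noncomputable def mk (f : G → ℂ) : E :=
  if h : Memℓp (fun n => f n * (W n : ℂ)) 1 then ⟨fun n => f n * (W n : ℂ), h⟩ else 0

lemma raw_mk {f : G → ℂ} (hf : A f) : raw (mk f) = f := by
  have h : Memℓp (fun n => f n * (W n : ℂ)) 1 := by
    apply memℓp_gen
    have : ∀ n, ‖f n * (W n : ℂ)‖ = ‖f n‖ * W n := fun n => by
      rw [norm_mul, Complex.norm_real, Real.norm_eq_abs, abs_of_pos (W_pos n)]
    simp only [this, ENNReal.toReal_one, Real.rpow_one]
    exact hf
  ext n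
  have hW : (W n : ℂ) ≠ 0 := by exact_mod_cast (W_pos n).ne'
  simp only [raw, mk, h, dite_true]
  field_simp

lemma raw_cont : Continuous (fun c : E => raw c) := by
  refine continuous_pi fun n => ?_
  unfold raw
  have h : Continuous (fun c : E => (c : G → ℂ)) := (lp.uniformContinuous_coe (p := 1)).continuous
  exact ((continuous_apply n).comp h).div_const _

lemma Sy_closed : IsClosed {f : G → ℂ | Sy (-1) f ∧ ∀ n ∈ R, f n = 0} := by
  have e : {f : G → ℂ | Sy (-1) f ∧ ∀ n ∈ R, f n = 0} =
      (⋂ l : ℤ, ⋂ j : ℤ, {f : G → ℂ | f (-l, -j) = (starRingEnd ℂ) (f (l, j))}) ∩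
      ((⋂ l : ℤ, ⋂ j : ℤ, {f : G → ℂ | f (l, -j) = (-1) * f (l, j)}) ∩
      ((⋂ l : ℤ, ⋂ j : ℤ, {f : G → ℂ | (-1 : ℂ) ^ l * f (l, j) = (-1) * f (l, j)}) ∩
      (⋂ n : G, ⋂ _ : n ∈ R, {f : G → ℂ | f n = 0}))) := by
    ext f
    simp only [Set.mem_inter_iff, Set.mem_iInter, Set.mem_ofPred_eq]
    constructor
    · rintro ⟨h, h'⟩; exact ⟨h.conj, h.odd, h.par, h'⟩
    · rintro ⟨a, b, c, d⟩; exact ⟨⟨a, b, c⟩, d⟩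
  rw [e]
  refine IsClosed.inter ?_ (IsClosed.inter ?_ (IsClosed.inter ?_ ?_))
  · exact isClosed_iInter fun l => isClosed_iInter fun j =>
      isClosed_eq (continuous_apply _) (Complex.continuous_conj.comp (continuous_apply _))
  · exact isClosed_iInter fun l => isClosed_iInter fun j =>
      isClosed_eq (continuous_apply _) (continuous_const.mul (continuous_apply _))
  · exact isClosed_iInter fun l => isClosed_iInter fun j =>
      isClosed_eq (continuous_const.mul (continuous_apply _))
        (continuous_const.mul (continuous_apply _))
  · exact isClosed_iInter fun n => isClosed_iInter fun _ =>
      isClosed_eq (continuous_apply _) continuous_const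

lemma Om_neg (l j : ℤ) : Om (-l, -j) ↔ Om (l, j) := by
  constructor
  · rintro ⟨a, b, c⟩
    refine ⟨by simpa using a, by simpa using b, fun h => c ?_⟩
    simp only [R, Finset.mem_insert, Finset.mem_singleton, Prod.mk.injEq] at h ⊢
    omega
  · rintro ⟨a, b, c⟩
    refine ⟨by simpa using a, by simpa using b, fun h => c ?_⟩
    simp only [R, Finset.mem_insert, Finset.mem_singleton, Prod.mk.injEq] at h ⊢
    omega

lemma Om_neg' (l j : ℤ) : Om (l, -j) ↔ Om (l, j) := by
  constructor
  · rintro ⟨a, b, c⟩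
    refine ⟨by simpa using a, by simpa using b, fun h => c ?_⟩
    simp only [R, Finset.mem_insert, Finset.mem_singleton, Prod.mk.injEq] at h ⊢
    omega
  · rintro ⟨a, b, c⟩
    refine ⟨by simpa using a, by simpa using b, fun h => c ?_⟩
    simp only [R, Finset.mem_insert, Finset.mem_singleton, Prod.mk.injEq] at h ⊢
    omega

lemma Sy_tau {Φ : G → ℂ} (h : Sy (-1) Φ) (m ν : ℝ) (φ : ℂ) :
    Sy (-1) (fun n => tau m ν φ n * Φ n) where
  conj l j := by
    have hO := Om_neg l j
    by_cases hn : Om (l, j)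
    · have hn' := hO.2 hn
      simp only [tau, hn, hn', if_true, h.conj]
      simp only [map_mul, map_div₀, conj_I, conj_ofReal, sym, Dn, map_add, map_intCast]
      push_cast
      congr 1
      rw [show (-I * ν * (l:ℂ)) = I * ν * (-l) by ring]
      congr 1
      ring
    · have hn' := mt hO.1 hn
      simp [tau, hn, hn']
  odd l j := by
    have hO := Om_neg' l j
    by_cases hn : Om (l, j)
    · have hn' := hO.2 hn
      simp only [tau, hn, hn', if_true, h.odd l j]
      simp only [sym, Dn]; push_cast; ring
    · have hn' := mt hO.1 hn
      simp [tau, hn, hn']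
  par l j := by
    have := h.par l j
    calc _ = tau m ν φ (l, j) * ((-1 : ℂ) ^ l * Φ (l, j)) := by ring
      _ = _ := by rw [this]; ring

lemma tau_R {m ν : ℝ} {φ : ℂ} {n : G} (hn : n ∈ R) : tau m ν φ n = 0 := by
  unfold tau
  rw [if_neg]
  exact fun h => h.nR hn

lemma prod_lip {τ1 τ2 Φ1 Φ2 : G → ℂ} (h1 : A Φ1) (h2 : A Φ2) {ε η : ℝ}
    (hτ : ∀ n, ‖τ1 n‖ ≤ ε) (hη : ∀ n, ‖τ1 n - τ2 n‖ ≤ η) :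
    N ((fun n => τ1 n * Φ1 n) - (fun n => τ2 n * Φ2 n)) ≤ ε * N (Φ1 - Φ2) + η * N Φ2 := by
  have e : ((fun n => τ1 n * Φ1 n) - (fun n => τ2 n * Φ2 n)) =
    (fun n => τ1 n * (Φ1 - Φ2) n) + (fun n => (τ1 n - τ2 n) * Φ2 n) := by
    ext n; simp only [Pi.sub_apply, Pi.add_apply]; ring
  have a1 : ∀ n, ‖τ1 n * (Φ1 - Φ2) n‖ ≤ ε * ‖(Φ1 - Φ2) n‖ := fun n => by
    rw [norm_mul]; exact mul_le_mul_of_nonneg_right (hτ n) (norm_nonneg _)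
  have a2 : ∀ n, ‖(τ1 n - τ2 n) * Φ2 n‖ ≤ η * ‖Φ2 n‖ := fun n => by
    rw [norm_mul]; exact mul_le_mul_of_nonneg_right (hη n) (norm_nonneg _)
  rw [e]
  exact (N_add_le ((h1.sub h2).mono a1) (h2.mono a2)).trans
    (add_le_add (N_mono (h1.sub h2) a1) (N_mono h2 a2))

lemma A_tau {τ Φ : G → ℂ} (h : A Φ) {ε : ℝ} (hτ : ∀ n, ‖τ n‖ ≤ ε) :
    A (fun n => τ n * Φ n) ∧ N (fun n => τ n * Φ n) ≤ ε * N Φ := by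
  have a1 : ∀ n, ‖τ n * Φ n‖ ≤ ε * ‖Φ n‖ := fun n => by
    rw [norm_mul]; exact mul_le_mul_of_nonneg_right (hτ n) (norm_nonneg _)
  exact ⟨h.mono a1, N_mono h a1⟩

/-- nonlinearity -/
noncomputable def Ph (p : ℕ) (z : G → ℂ) : G → ℂ := pw (s0 + z) (2 * p)
noncomputable def ph (p : ℕ) (z : G → ℂ) : ℂ := Ph p z (1, 1)

noncomputable def bB : ℝ := N s0 + 1
noncomputable def bL (p : ℕ) : ℝ := (2 * p + 1) * bB ^ (2 * p)
noncomputable def bK (p : ℕ) : ℝ := bB ^ (2 * p + 1)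
noncomputable def ph0 (p : ℕ) : ℝ := g0 (2 * p) 1 ^ 2

lemma bB_pos : 1 ≤ bB := by unfold bB; linarith [N_nonneg s0]
lemma bL_pos (p : ℕ) : 0 < bL p := by have := bB_pos; unfold bL; positivity
lemma bK_pos (p : ℕ) : 0 < bK p := by have := bB_pos; unfold bK; positivity
lemma ph0_pos (p : ℕ) : 0 < ph0 p := by have := g0_ne p; unfold ph0; positivity

lemma N_base {z : G → ℂ} (hz : A z) (h : N z ≤ 1) : N (s0 + z) ≤ bB :=
  (N_add_le A_s0 hz).trans (by unfold bB; linarith)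

lemma A_Ph (p : ℕ) {z : G → ℂ} (hz : A z) : A (Ph p z) := (A_s0.add hz).pw _

lemma Ph_le (p : ℕ) {z : G → ℂ} (hz : A z) (h : N z ≤ 1) : N (Ph p z) ≤ bK p :=
  N_pw_le (A_s0.add hz) (N_base hz h) _

lemma Ph_lip (p : ℕ) {z z' : G → ℂ} (hz : A z) (h : N z ≤ 1) (hz' : A z') (h' : N z' ≤ 1) :
    N (Ph p z - Ph p z') ≤ bL p * N (z - z') := by
  have := N_pw_sub_le (A_s0.add hz) (A_s0.add hz') (N_base hz h) (N_base hz' h') (2 * p)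
  rw [add_sub_add_left_eq_sub] at this
  push_cast at this
  exact this

lemma ph_le (p : ℕ) {z : G → ℂ} (hz : A z) (h : N z ≤ 1) : ‖ph p z‖ ≤ bK p :=
  (norm_le_N (A_Ph p hz) _).trans (Ph_le p hz h)

lemma ph_lip (p : ℕ) {z z' : G → ℂ} (hz : A z) (h : N z ≤ 1) (hz' : A z') (h' : N z' ≤ 1) :
    ‖ph p z - ph p z'‖ ≤ bL p * N (z - z') :=
  (norm_le_N ((A_Ph p hz).sub (A_Ph p hz')) (1,1)).trans (Ph_lip p hz h hz' h')

lemma ph_zero (p : ℕ) : ph p 0 = (ph0 p : ℂ) := by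
  simp only [ph, Ph, add_zero, pw_s0, ph0, sq]

lemma A_zero : A 0 := by simp [A, summable_zero]
lemma N_zero : N 0 = 0 := by simp [N]

lemma ph_near (p : ℕ) {z : G → ℂ} (hz : A z) (h : N z ≤ 1) :
    ‖ph p z - (ph0 p : ℂ)‖ ≤ bL p * N z := by
  have := ph_lip p hz h A_zero (by rw [N_zero]; norm_num)
  rwa [ph_zero, sub_zero] at this

lemma ph_im (p : ℕ) {z : G → ℂ} (hz : A z) (h : N z ≤ 1) : |(ph p z).im| ≤ bL p * N z := by
  refine le_trans ?_ (ph_near p hz h)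
  simpa using abs_im_le_norm (ph p z - (ph0 p : ℂ))

lemma ph_re (p : ℕ) {z : G → ℂ} (hz : A z) (h : N z ≤ 1) (h2 : bL p * N z ≤ ph0 p / 2) :
    ph0 p / 2 ≤ (ph p z).re := by
  have h1 := (abs_re_le_norm (ph p z - (ph0 p : ℂ))).trans (ph_near p hz h)
  simp only [sub_re, ofReal_re] at h1
  have := (abs_le.1 h1).1
  linarith

lemma Sy_Ph (p : ℕ) {z : G → ℂ} (hz : Sy (-1) z) : Sy (-1) (Ph p z) := by
  have := (Sy_s0.add hz).pw (2 * p)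
  have e : (-1 : ℂ) ^ (2 * p + 1) = -1 := by rw [pow_succ, pow_mul]; simp
  rwa [e] at this

end SDB
namespace SDB
open Complex

noncomputable def Psi (m : ℝ) (p : ℕ) (μ : ℝ) (q : E × ℝ) : E × ℝ :=
  (mk (fun n => tau m (μ * q.2 ^ (2 * p + 1)) (ph p (raw q.1)) n * Ph p (raw q.1) n),
    Real.sqrt (1 + m + μ * q.2 ^ (2 * p + 1) * (4 * (ph p (raw q.1)).im)))

def SS (m δ : ℝ) : Set (E × ℝ) :=
  {q | (Sy (-1) (raw q.1) ∧ ∀ n ∈ R, raw q.1 n = 0) ∧ ‖q.1‖ ≤ δ ∧ q.2 ∈ Set.Icc 1 (2 + m)}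

lemma SS_closed (m δ : ℝ) : IsClosed (SS m δ) := by
  unfold SS
  have h1 : IsClosed {q : E × ℝ | Sy (-1) (raw q.1) ∧ ∀ n ∈ R, raw q.1 n = 0} :=
    Sy_closed.preimage (raw_cont.comp continuous_fst)
  have h2 : IsClosed {q : E × ℝ | ‖q.1‖ ≤ δ} :=
    isClosed_le (continuous_norm.comp continuous_fst) continuous_const
  have h3 : IsClosed {q : E × ℝ | q.2 ∈ Set.Icc 1 (2 + m)} :=
    isClosed_Icc.preimage continuous_snd
  exact h1.inter (h2.inter h3)

lemma sqrt_lip {a b : ℝ} (ha : 1 ≤ a) (hb : 1 ≤ b) : |Real.sqrt a - Real.sqrt b| ≤ |a - b| := by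
  have h1 := Real.one_le_sqrt.2 ha
  have h2 := Real.one_le_sqrt.2 hb
  have e : a - b = (Real.sqrt a - Real.sqrt b) * (Real.sqrt a + Real.sqrt b) := by
    have := Real.sq_sqrt (zero_le_one.trans ha)
    have := Real.sq_sqrt (zero_le_one.trans hb)
    nlinarith
  rw [e, abs_mul, abs_of_pos (by linarith : 0 < Real.sqrt a + Real.sqrt b)]
  nlinarith [abs_nonneg (Real.sqrt a - Real.sqrt b)]

lemma pow_lip {m a b : ℝ} (p : ℕ) (ha : a ∈ Set.Icc 1 (2 + m)) (hb : b ∈ Set.Icc 1 (2 + m)) :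
    |a ^ (2 * p + 1) - b ^ (2 * p + 1)| ≤ (2 * p + 1) * (2 + m) ^ (2 * p) * |a - b| := by
  have h := abs_pow_sub_pow_le a b (2 * p + 1)
  have h1 : max |a| |b| ≤ 2 + m := by
    rw [abs_of_pos (by linarith [ha.1]), abs_of_pos (by linarith [hb.1])]
    exact max_le ha.2 hb.2
  refine h.trans ?_
  push_cast
  calc |a - b| * (2 * p + 1) * max |a| |b| ^ (2 * p) ≤ |a - b| * (2 * p + 1) * (2 + m) ^ (2 * p) := by
        gcongr
    _ = _ := by ring

lemma pow_range {m a : ℝ} (p : ℕ) (ha : a ∈ Set.Icc 1 (2 + m)) :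
    1 ≤ a ^ (2 * p + 1) ∧ a ^ (2 * p + 1) ≤ (2 + m) ^ (2 * p + 1) :=
  ⟨one_le_pow₀ ha.1, pow_le_pow_left₀ (by linarith [ha.1]) ha.2 _⟩

lemma small_z (p : ℕ) {z τ : G → ℂ} (hAz : A z) (f1 : N z ≤ 1) {ε κ : ℝ} (hκ : 0 ≤ κ)
    (hε : 0 ≤ ε) (hεL : ε * bL p ≤ 1/2) (hz : z = fun n => τ n * Ph p z n)
    (hτε : ∀ n, ‖τ n‖ ≤ ε) (hτκ : ∀ n : G, |n.2| ≤ (2 * p + 1 : ℕ) → ‖τ n‖ ≤ κ) :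
    N z ≤ 2 * (κ * bK p) := by
  have hA0 : A (Ph p 0) := A_Ph p A_zero
  have t1 : ∀ n, ‖τ n * Ph p 0 n‖ ≤ κ * ‖Ph p 0 n‖ := by
    intro n
    by_cases hj : |n.2| ≤ (2 * p + 1 : ℕ)
    · rw [norm_mul]
      exact mul_le_mul_of_nonneg_right (hτκ n hj) (norm_nonneg _)
    · push Not at hj
      have : Ph p 0 n = 0 := by
        obtain ⟨l, j⟩ := n
        have z0 : g0 (2 * p) j = 0 := g0_supp _ _ (by push_cast at hj ⊢; exact hj)
        simp only [Ph, add_zero, pw_s0, z0]; simp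
      simp [this]
  have t2 : ∀ n, ‖τ n * (Ph p z - Ph p 0) n‖ ≤ ε * ‖(Ph p z - Ph p 0) n‖ := fun n => by
    rw [norm_mul]; exact mul_le_mul_of_nonneg_right (hτε n) (norm_nonneg _)
  have hAd : A (Ph p z - Ph p 0) := (A_Ph p hAz).sub hA0
  have e : z = (fun n => τ n * Ph p 0 n) + (fun n => τ n * (Ph p z - Ph p 0) n) := by
    conv_lhs => rw [hz]
    ext n; simp only [Pi.add_apply, Pi.sub_apply]; ring
  have h1 : N z ≤ κ * N (Ph p 0) + ε * N (Ph p z - Ph p 0) := by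
    conv_lhs => rw [e]
    exact (N_add_le (hA0.mono t1) (hAd.mono t2)).trans
      (add_le_add (N_mono hA0 t1) (N_mono hAd t2))
  have h2 := Ph_le p A_zero (by rw [N_zero]; norm_num)
  have h3 := Ph_lip p hAz f1 A_zero (by rw [N_zero]; norm_num)
  rw [sub_zero] at h3
  have h4 : κ * N (Ph p 0) ≤ κ * bK p := by gcongr
  have h5 : ε * N (Ph p z - Ph p 0) ≤ ε * (bL p * N z) := by gcongr
  have h6 : ε * (bL p * N z) ≤ 1/2 * N z := by
    rw [← mul_assoc]; exact mul_le_mul_of_nonneg_right hεL (N_nonneg _)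
  linarith

set_option maxHeartbeats 2000000 in
theorem core (p : ℕ) {m : ℝ} (hm : 0 < m) (hmi : Irrational m) :
    ∃ μ0 > 0, ∃ C > 0, ∀ μ : ℝ, 0 < μ → μ ≤ μ0 → ∃ (z : G → ℂ) (ω : ℝ),
      A z ∧ Sy (-1) z ∧ (∀ n ∈ R, z n = 0) ∧ N z ≤ C * μ ∧ ω ∈ Set.Icc 1 (2 + m) ∧
      ph0 p / 2 ≤ (ph p z).re ∧ |(ph p z).im| ≤ C * μ ∧
      ω ^ 2 = 1 + m + μ * ω ^ (2 * p + 1) * (4 * (ph p z).im) ∧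
      ∀ n, Om n → z n * sym m (μ * ω ^ (2 * p + 1)) (ph p z) n
        = I * ((μ * ω ^ (2 * p + 1) : ℝ) : ℂ) * n.1 * Ph p z n := by
  have hL := bL_pos p
  have hK := bK_pos p
  have hφ0 := ph0_pos p
  set L := bL p with hLd
  set K := bK p with hKd
  set φ0 := ph0 p with hφ0d
  obtain ⟨δ, hδ, hδ1, hδL⟩ : ∃ δ > 0, δ ≤ 1 ∧ L * δ ≤ φ0 / 2 := by
    refine ⟨min 1 (φ0 / (2 * L)), by positivity, min_le_left _ _, ?_⟩
    calc L * min 1 (φ0 / (2 * L)) ≤ L * (φ0 / (2 * L)) := by gcongr; exact min_le_right _ _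
      _ = φ0 / 2 := by field_simp
  have hq0 : 0 < 2 * φ0 := by positivity
  obtain ⟨q0, hq0d⟩ : ∃ q0, q0 = 2 * φ0 := ⟨_, rfl⟩
  rw [← hq0d] at hq0
  obtain ⟨β0, hβ0d⟩ : ∃ β0, β0 = 4 * K := ⟨_, rfl⟩
  have hβ0 : 0 < β0 := by rw [hβ0d]; positivity
  obtain ⟨Λ, hΛd⟩ : ∃ Λ, Λ = (2 + m) ^ (2 * p + 1) := ⟨_, rfl⟩
  have hΛ : 0 < Λ := by rw [hΛd]; positivity
  obtain ⟨H, hHd⟩ : ∃ H, H = (2 * p + 1) * (2 + m) ^ (2 * p) := ⟨_, rfl⟩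
  have hH : 0 < H := by rw [hHd]; positivity
  obtain ⟨K', hK'd⟩ : ∃ K', K' = ((1 + β0 * (4/q0 + 2)) + 8 * (4/q0+2)) := ⟨_, rfl⟩
  have hK' : 0 < K' := by rw [hK'd]; positivity
  obtain ⟨Z, hZd⟩ : ∃ Z, Z = L + K' * (H + L) * K := ⟨_, rfl⟩
  have hZ : 0 < Z := by rw [hZd]; positivity
  obtain ⟨ε, hε, hεZ, hεK⟩ : ∃ ε > 0, ε * Z ≤ 1/2 ∧ ε * K ≤ δ := by
    refine ⟨min (1 / (2 * Z)) (δ / K), by positivity, ?_, ?_⟩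
    · calc _ ≤ (1 / (2 * Z)) * Z := by gcongr; exact min_le_left _ _
        _ = 1/2 := by field_simp
    · calc _ ≤ (δ / K) * K := by gcongr; exact min_le_right _ _
        _ = δ := by field_simp
  have hεL : ε * L ≤ 1/2 := by
    refine le_trans ?_ hεZ
    gcongr
    rw [hZd]
    have : 0 ≤ K' * (H + L) * K := by positivity
    linarith
  obtain ⟨ν1, hν1, hB1⟩ := sym_B1 hm hmi hq0 hβ0.le hε
  obtain ⟨CJ, hCJ, ν2, hν2, hB2⟩ := sym_fin hm hmi (2 * p + 1) hβ0.le
  obtain ⟨νm, hνm, hm1, hm2, hm3, hm4, hm5⟩ : ∃ νm > 0, νm ≤ ν1 ∧ νm ≤ ν2 ∧ νm ≤ 1 ∧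
      νm * β0 ≤ 1/4 ∧ νm * β0 ≤ m := by
    refine ⟨min (min ν1 ν2) (min 1 (min (1 / (4 * β0)) (m / β0))), by positivity,
      (min_le_left _ _).trans (min_le_left _ _), (min_le_left _ _).trans (min_le_right _ _),
      (min_le_right _ _).trans (min_le_left _ _), ?_, ?_⟩
    · calc _ ≤ (1 / (4 * β0)) * β0 := by
            gcongr
            exact (min_le_right _ _).trans ((min_le_right _ _).trans (min_le_left _ _))
        _ = 1/4 := by field_simp
    · calc _ ≤ (m / β0) * β0 := by
            gcongr
            exact (min_le_right _ _).trans ((min_le_right _ _).trans (min_le_right _ _))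
        _ = m := by field_simp
  obtain ⟨μ0, hμ0, hμΛ, hμω⟩ : ∃ μ0 > 0, μ0 * Λ ≤ νm ∧ 4 * μ0 * (H * K + Λ * L) ≤ 1/2 := by
    refine ⟨min (νm / Λ) (1 / (8 * (H * K + Λ * L))), by positivity, ?_, ?_⟩
    · calc _ ≤ (νm / Λ) * Λ := by gcongr; exact min_le_left _ _
        _ = νm := by field_simp
    · calc _ ≤ 4 * (1 / (8 * (H * K + Λ * L))) * (H * K + Λ * L) := by
            gcongr; exact min_le_right _ _
        _ = 1/2 := by field_simp; norm_num
  obtain ⟨C0, hC0d⟩ : ∃ C0, C0 = 2 * (Λ * CJ * K) := ⟨_, rfl⟩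
  have hC0 : 0 < C0 := by rw [hC0d]; positivity
  refine ⟨μ0, hμ0, C0 + L * C0, by positivity, ?_⟩
  intro μ hμ hμμ
  -- facts for elements of the set
  have fac : ∀ q ∈ SS m δ, N (raw q.1) ≤ 1 ∧ q0 ≤ 4 * (ph p (raw q.1)).re ∧
      |4 * (ph p (raw q.1)).im| ≤ β0 ∧ 1 ≤ q.2 ^ (2 * p + 1) ∧ q.2 ^ (2 * p + 1) ≤ Λ ∧
      μ * q.2 ^ (2 * p + 1) ≤ νm := by
    rintro q ⟨hq1, hq2, hq3⟩
    rw [norm_raw] at hq2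
    have hN1 : N (raw q.1) ≤ 1 := hq2.trans hδ1
    obtain ⟨r1, r2⟩ := pow_range p hq3
    rw [← hΛd] at r2
    refine ⟨hN1, ?_, ?_, r1, r2, ?_⟩
    · have : L * N (raw q.1) ≤ φ0 / 2 := le_trans (by gcongr) hδL
      have := ph_re p (A_raw q.1) hN1 this
      rw [hq0d]; linarith
    · rw [abs_mul, abs_of_pos (by norm_num : (0:ℝ) < 4), hβ0d]
      have := (abs_im_le_norm _).trans (ph_le p (A_raw q.1) hN1)
      linarith
    · calc μ * q.2 ^ (2 * p + 1) ≤ μ0 * Λ := by gcongr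
        _ ≤ νm := hμΛ
  have hνpos : ∀ q ∈ SS m δ, 0 < μ * q.2 ^ (2 * p + 1) := fun q hq =>
    mul_pos hμ (by linarith [(fac q hq).2.2.2.1])
  have hB : ∀ q ∈ SS m δ, ∀ n, Om n → μ * q.2 ^ (2 * p + 1) * |(n.1:ℝ)| ≤
      ε * ‖sym m (μ * q.2 ^ (2 * p + 1)) (ph p (raw q.1)) n‖ := fun q hq n hn => by
    obtain ⟨f1, f2, f3, f4, f5, f6⟩ := fac q hq
    exact hB1 _ _ n (hνpos q hq) (f6.trans hm1) f2 f3 hn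
  have hτ : ∀ q ∈ SS m δ, ∀ n, ‖tau m (μ * q.2 ^ (2 * p + 1)) (ph p (raw q.1)) n‖ ≤ ε :=
    fun q hq n => tau_norm hε.le (hνpos q hq) (hB q hq n)
  have hω1 : ∀ q ∈ SS m δ, |μ * q.2 ^ (2 * p + 1) * (4 * (ph p (raw q.1)).im)| ≤ νm * β0 := by
    intro q hq
    obtain ⟨f1, f2, f3, f4, f5, f6⟩ := fac q hq
    rw [abs_mul, abs_of_pos (hνpos q hq)]
    exact mul_le_mul f6 f3 (abs_nonneg _) hνm.le
  have hω2 : ∀ q ∈ SS m δ, 1 ≤ 1 + m + μ * q.2 ^ (2 * p + 1) * (4 * (ph p (raw q.1)).im) := by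
    intro q hq
    have := (abs_le.1 (hω1 q hq)).1
    linarith
  have hAT : ∀ q ∈ SS m δ, A (fun n => tau m (μ * q.2 ^ (2 * p + 1)) (ph p (raw q.1)) n *
      Ph p (raw q.1) n) := fun q hq => (A_tau (A_Ph p (A_raw q.1)) (hτ q hq)).1
  have maps : Set.MapsTo (Psi m p μ) (SS m δ) (SS m δ) := by
    intro q hq
    obtain ⟨f1, f2, f3, f4, f5, f6⟩ := fac q hq
    have hr : raw (Psi m p μ q).1 = _ := raw_mk (hAT q hq)
    refine ⟨?_, ?_, ?_, ?_⟩
    · rw [hr]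
      exact ⟨Sy_tau (Sy_Ph p hq.1.1) _ _ _, fun n hn => by simp only [tau_R hn, zero_mul]⟩
    · rw [norm_raw, hr]
      refine ((A_tau (A_Ph p (A_raw q.1)) (hτ q hq)).2).trans (le_trans ?_ hεK)
      gcongr
      exact Ph_le p (A_raw q.1) f1
    · exact Real.one_le_sqrt.2 (hω2 q hq)
    · refine Real.sqrt_le_iff.2 ⟨by linarith, ?_⟩
      have := (abs_le.1 (hω1 q hq)).2
      nlinarith
  have lip : ∀ a ∈ SS m δ, ∀ b ∈ SS m δ,
      dist (Psi m p μ a) (Psi m p μ b) ≤ 1/2 * dist a b := by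
    intro a ha b hb
    obtain ⟨f1, f2, f3, f4, f5, f6⟩ := fac a ha
    obtain ⟨g1, g2, g3, g4, g5, g6⟩ := fac b hb
    have d1 : N (raw a.1 - raw b.1) ≤ dist a b := by
      rw [← dist_raw]; exact le_max_left _ _
    have d2 : |a.2 - b.2| ≤ dist a b := by
      rw [← Real.dist_eq]; exact le_max_right _ _
    set d := dist a b with hd
    have d0 : 0 ≤ d := dist_nonneg
    have e1 : |a.2 ^ (2 * p + 1) - b.2 ^ (2 * p + 1)| ≤ H * d := by
      refine (pow_lip p ha.2.2 hb.2.2).trans ?_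
      rw [← hHd]; gcongr
    have e2 : ‖ph p (raw a.1) - ph p (raw b.1)‖ ≤ L * d :=
      (ph_lip p (A_raw a.1) f1 (A_raw b.1) g1).trans (by gcongr)
    have e3 : N (Ph p (raw a.1) - Ph p (raw b.1)) ≤ L * d :=
      (Ph_lip p (A_raw a.1) f1 (A_raw b.1) g1).trans (by gcongr)
    rw [Prod.dist_eq]
    refine max_le ?_ ?_
    · have hra : raw (Psi m p μ a).1 = _ := raw_mk (hAT a ha)
      have hrb : raw (Psi m p μ b).1 = _ := raw_mk (hAT b hb)
      rw [dist_raw, hra, hrb]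
      have hη : ∀ n, ‖tau m (μ * a.2 ^ (2 * p + 1)) (ph p (raw a.1)) n -
          tau m (μ * b.2 ^ (2 * p + 1)) (ph p (raw b.1)) n‖ ≤ ε * K' * (H * d + L * d) := by
        intro n
        have := tau_lip (m := m) (ε := ε) (n := n) hm hε.le hq0 hβ0.le hμ f4 g4 (f6.trans hm3)
          (g6.trans hm3) f2 g2 f3 g3 (le_trans (by gcongr) hm4) (le_trans (by gcongr) hm4)
          (hB a ha n)
        refine this.trans ?_
        rw [← hK'd]
        gcongr
      refine (prod_lip (A_Ph p (A_raw a.1)) (A_Ph p (A_raw b.1)) (hτ a ha) hη).trans ?_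
      calc ε * N (Ph p (raw a.1) - Ph p (raw b.1)) + ε * K' * (H * d + L * d) * N (Ph p (raw b.1))
          ≤ ε * (L * d) + ε * K' * (H * d + L * d) * K := by
            gcongr
            exact Ph_le p (A_raw b.1) g1
        _ = (ε * Z) * d := by rw [hZd]; ring
        _ ≤ 1/2 * d := by gcongr
    · rw [Real.dist_eq]
      refine (sqrt_lip (hω2 a ha) (hω2 b hb)).trans ?_
      have i1 : |(ph p (raw a.1)).im| ≤ K := (abs_im_le_norm _).trans (ph_le p (A_raw a.1) f1)
      have i2 : |(ph p (raw a.1)).im - (ph p (raw b.1)).im| ≤ L * d := by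
        refine le_trans ?_ e2
        simpa using abs_im_le_norm (ph p (raw a.1) - ph p (raw b.1))
      have e : (1 + m + μ * a.2 ^ (2 * p + 1) * (4 * (ph p (raw a.1)).im)) -
          (1 + m + μ * b.2 ^ (2 * p + 1) * (4 * (ph p (raw b.1)).im)) =
          4 * μ * ((a.2 ^ (2 * p + 1) - b.2 ^ (2 * p + 1)) * (ph p (raw a.1)).im +
            b.2 ^ (2 * p + 1) * ((ph p (raw a.1)).im - (ph p (raw b.1)).im)) := by ring
      rw [e, abs_mul, abs_of_pos (by positivity : 0 < 4 * μ)]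
      calc _ ≤ 4 * μ * (H * d * K + Λ * (L * d)) := by
            gcongr
            refine (abs_add_le _ _).trans ?_
            rw [abs_mul, abs_mul]
            have : |b.2 ^ (2 * p + 1)| ≤ Λ := by rw [abs_of_pos (by linarith)]; exact g5
            gcongr
        _ = (4 * μ * (H * K + Λ * L)) * d := by ring
        _ ≤ (4 * μ0 * (H * K + Λ * L)) * d := by gcongr
        _ ≤ 1/2 * d := by gcongr
  have cont : ContractingWith (1/2 : NNReal) (maps.restrict (Psi m p μ) (SS m δ) (SS m δ)) := by
    refine ⟨by rw [← NNReal.coe_lt_coe]; norm_num, LipschitzWith.of_dist_le_mul fun a b => ?_⟩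
    have := lip a.1 a.2 b.1 b.2
    simpa [Subtype.dist_eq] using this
  have hx0 : ((0 : E), (1:ℝ)) ∈ SS m δ := by
    have hr0 : raw (0 : E) = 0 := by ext n; simp [raw]
    refine ⟨⟨?_, fun n _ => by simp [hr0]⟩, by simpa using hδ.le, by constructor <;> simp; linarith⟩
    simp only [hr0]
    exact ⟨by simp, by simp, by simp⟩
  obtain ⟨q, hqS, hqf, -⟩ := cont.exists_fixedPoint' (SS_closed m δ).isComplete maps hx0
    (edist_ne_top _ _)
  have hfix : Psi m p μ q = q := hqf
  obtain ⟨f1, f2, f3, f4, f5, f6⟩ := fac q hqS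
  have hz : raw q.1 = fun n => tau m (μ * q.2 ^ (2 * p + 1)) (ph p (raw q.1)) n * Ph p (raw q.1) n := by
    have hr : raw (Psi m p μ q).1 = _ := raw_mk (hAT q hqS)
    rw [hfix] at hr
    exact hr
  have hω : q.2 = Real.sqrt (1 + m + μ * q.2 ^ (2 * p + 1) * (4 * (ph p (raw q.1)).im)) := by
    have : (Psi m p μ q).2 = q.2 := by rw [hfix]
    exact this.symm
  have hAz := A_raw q.1
  have hNz : N (raw q.1) ≤ C0 * μ := by
    refine (small_z p hAz f1 (ε := ε) (κ := μ * Λ * CJ) (by positivity) hε.le hεL hz (hτ q hqS) ?_).trans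
      (by rw [hC0d]; apply le_of_eq; ring)
    intro n hj
    refine tau_norm (by positivity) (hνpos q hqS) fun hn => ?_
    have := hB2 (μ * q.2 ^ (2 * p + 1)) (ph p (raw q.1)) n (hνpos q hqS) (f6.trans hm2) f3 hn hj
    calc μ * q.2 ^ (2 * p + 1) * |(n.1:ℝ)| ≤
        μ * Λ * (CJ * ‖sym m (μ * q.2 ^ (2 * p + 1)) (ph p (raw q.1)) n‖) := by
          gcongr
      _ = _ := by ring
  refine ⟨raw q.1, q.2, hAz, hqS.1.1, hqS.1.2, ?_, hqS.2.2, ?_, ?_, ?_, ?_⟩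
  · refine hNz.trans ?_
    have : 0 ≤ L * C0 * μ := by positivity
    linarith
  · rw [hq0d] at f2; linarith
  · refine (ph_im p hAz f1).trans ?_
    have : L * N (raw q.1) ≤ L * (C0 * μ) := by gcongr
    have : 0 ≤ C0 * μ := by positivity
    nlinarith
  · conv_lhs => rw [hω]
    exact Real.sq_sqrt (by linarith [hω2 q hqS])
  · intro n hn
    have hs : 0 < ‖sym m (μ * q.2 ^ (2 * p + 1)) (ph p (raw q.1)) n‖ := by
      have a := hB q hqS n hn
      have b := hn.l_ge
      have c := hνpos q hqS
      have : 0 < ε * ‖sym m (μ * q.2 ^ (2 * p + 1)) (ph p (raw q.1)) n‖ :=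
        lt_of_lt_of_le (by positivity) a
      exact pos_of_mul_pos_right this hε.le
    have hs' := norm_pos_iff.1 hs
    have := congrFun hz n
    simp only [tau, hn, if_true] at this
    conv_lhs => rw [this]
    field_simp

end SDB
namespace SDB
open Complex

lemma coef_id {p : ℕ} {m ν : ℝ} {z : G → ℂ} (hs : Sy (-1) z) (hR : ∀ n ∈ R, z n = 0)
    (hz : ∀ n, Om n → z n * sym m ν (ph p z) n = I * (ν : ℂ) * n.1 * Ph p z n) (n : G) :
    sym m ν (ph p z) n * it (s0 + z) n = ν * Ph p z n := by
  have hy := Sy_s0.add hs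
  have hP := Sy_Ph p hs
  by_cases hO : Om n
  · have h := hz n hO
    have hl : (n.1 : ℂ) ≠ 0 := by
      have := hO.l_ge
      intro h0
      have h1 : n.1 = 0 := by exact_mod_cast h0
      rw [h1] at this; norm_num at this
    have hI := I_ne_zero
    simp only [it, Pi.add_apply, s0_off hO.nR, zero_add]
    field_simp
    linear_combination h
  · by_cases hn : n ∈ R
    · have e11 : (s0 + z) (1,1) = 1/4 := by
        simp only [Pi.add_apply, hR (1,1) (by simp [R])]
        simp [s0, g0]; norm_num
      have y1 : (s0 + z) (1,-1) = -(1/4) := by rw [hy.odd, e11]; ring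
      have y2 : (s0 + z) (-1,-1) = 1/4 := by rw [hy.conj, e11]; simp [Complex.conj_ofNat]
      have y3 : (s0 + z) (-1,1) = -(1/4) := by
        have := hy.odd (-1) (-1)
        rw [neg_neg, y2] at this; rw [this]; ring
      have p0 : Ph p z (1,1) = ph p z := rfl
      have p1 : Ph p z (1,-1) = -ph p z := by rw [hP.odd, p0]; ring
      have p2 : Ph p z (-1,-1) = (starRingEnd ℂ) (ph p z) := by rw [hP.conj, p0]
      have p3 : Ph p z (-1,1) = -(starRingEnd ℂ) (ph p z) := by
        have := hP.odd (-1) (-1)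
        rw [neg_neg, p2] at this; rw [this]; ring
      have hI := I_ne_zero
      simp only [R, Finset.mem_insert, Finset.mem_singleton] at hn
      rcases hn with rfl | rfl | rfl | rfl
      · simp only [it, e11, p0, sym, Dn]
        apply Complex.ext <;> simp <;> ring
      · simp only [it, y1, p1, sym, Dn]
        apply Complex.ext <;> simp <;> ring
      · simp only [it, y3, p3, sym, Dn]
        apply Complex.ext <;> simp <;> ring
      · have e : (1/4 : ℂ) / (I * (((-1, -1) : G).1 : ℂ)) = I / 4 := by
          push_cast; field_simp; simp
        simp only [it, y2, p2, e, sym, Dn]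
        apply Complex.ext <;> simp <;> ring
    · obtain ⟨l, j⟩ := n
      by_cases hl : Even l
      · simp only [it, hy.zero_of_even hl, hP.zero_of_even hl]; simp
      · by_cases hj : j = 0
        · subst hj
          simp only [it, hy.zero_of_zero, hP.zero_of_zero]; simp
        · exact absurd ⟨Int.not_even_iff_odd.1 hl, hj, hn⟩ hO

lemma dt_it {y : G → ℂ} (hy : Sy (-1) y) : dt (it y) = y := by
  ext ⟨l, j⟩
  simp only [dt, it]
  by_cases hl : l = 0
  · subst hl
    rw [hy.zero_of_even (by simp)]; simp
  · have : (l : ℂ) ≠ 0 := by exact_mod_cast hl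
    have hI := I_ne_zero
    field_simp

lemma it_odd {y : G → ℂ} (hy : Sy (-1) y) (l j : ℤ) : it y (l, -j) = - it y (l, j) := by
  simp only [it, hy.odd]; ring

lemma re_dt {f : G → ℂ} (hf : RD f) (t x : ℝ) :
    deriv (fun s => (ev f s x).re) t = (ev (dt f) t x).re :=
  (Complex.reCLM.hasFDerivAt.comp_hasDerivAt t (ev_hasDerivAt_t hf t x)).deriv

lemma re_dx {f : G → ℂ} (hf : RD f) (t x : ℝ) :
    deriv (fun s => (ev f t s).re) x = (ev (dx f) t x).re :=
  (Complex.reCLM.hasFDerivAt.comp_hasDerivAt x (ev_hasDerivAt_x hf t x)).deriv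

/-- The PDE on the level of series. -/
lemma ev_pde {p : ℕ} {m μ ω : ℝ} {z : G → ℂ} (hA : A z) (hs : Sy (-1) z)
    (hω : ω ^ 2 = 1 + m + μ * ω ^ (2 * p + 1) * (4 * (ph p z).im))
    (hc : ∀ n, sym m (μ * ω ^ (2 * p + 1)) (ph p z) n * it (s0 + z) n =
      ((μ * ω ^ (2 * p + 1) : ℝ) : ℂ) * Ph p z n) (t x : ℝ) :
    (ω:ℂ)^2 * ev (dt (dt (it (s0 + z)))) t x - ev (dx (dx (it (s0 + z)))) t x
      - ω * ((4 * μ * ω ^ (2 * p) * (ph p z).re : ℝ) : ℂ) * ev (dt (dx (dx (it (s0 + z))))) t x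
      + m * ev (it (s0 + z)) t x = ((μ * ω ^ (2 * p + 1) : ℝ) : ℂ) * ev (s0 + z) t x ^ (2 * p + 1) := by
  have hAy := A_s0.add hA
  have hr : RD (it (s0 + z)) := hAy.it.RD
  rw [← ev_pw hAy (2 * p), ← ev_const_mul (pw (s0 + z) (2 * p))]
  have s1 := (hr.dt.dt.summ t x).hasSum.mul_left ((ω:ℂ)^2)
  have s2 := (hr.dx.dx.summ t x).hasSum
  have s3 := (hr.dx.dx.dt.summ t x).hasSum.mul_left (ω * ((4 * μ * ω ^ (2 * p) * (ph p z).re : ℝ) : ℂ))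
  have s4 := (hr.summ t x).hasSum.mul_left (m:ℂ)
  have s5 := ((s1.sub s2).sub s3).add s4
  refine s5.tsum_eq.symm.trans ?_
  refine tsum_congr fun n => ?_
  have h := hc n
  rw [show Ph p z n = pw (s0 + z) (2 * p) n from rfl] at h
  simp only [← h]
  have hω' : (ω:ℂ) ^ 2 = 1 + m + μ * ω ^ (2 * p + 1) * (4 * (ph p z).im) := by exact_mod_cast hω
  simp only [sym, Dn, dt, dx]
  push_cast
  rw [hω']
  linear_combination (it (s0 + z) n * ex n t x) * ((n.1:ℂ)^2 * (1 + m + μ * ω ^ (2 * p + 1) * (4 * (ph p z).im))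
     - (n.2:ℂ)^2 - (4 * μ * ω ^ (2 * p + 1) * (ph p z).re) * I * n.1 * (n.2:ℂ)^2) * I_sq

end SDB
theorem small_damping_bifurcation_rescaled
    (p : ℕ) (hp : 1 ≤ p) (m : ℝ) (hm : 0 < m) (hmi : Irrational m)
    (k0 : ℕ) (hk0 : 3 ≤ k0) :
    ∃ M > (0:ℝ), ∃ c > (0:ℝ), ∃ C > (0:ℝ), ∀ ρ : ℝ, 0 < ρ → ρ < M →
      ∃ α ω : ℝ,
        c * ρ ^ (2*p) ≤ α ∧
        |ω^2 - (1+m)| ≤ C * ρ^(2*p+1) ∧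
        ∃ u : ℝ → ℝ → ℝ,
          ContDiff ℝ k0 (fun q : ℝ × ℝ => u q.1 q.2) ∧
          (∀ t x : ℝ,
            ω^2 * pdtt u t x - pdxx u t x - ω * α * pdtxx u t x + m * u t x
              = ω^(2*p+1) * (pdt u t x)^(2*p+1)) ∧
          (∀ t : ℝ, u t 0 = 0 ∧ u t Real.pi = 0) ∧
          (∀ t x : ℝ, u (t + 2*Real.pi) x = u t x) ∧
          ∃ v : ℝ → ℝ → ℝ,
            (∀ t x : ℝ, u t x = ρ * Real.cos t * Real.sin x + v t x) ∧
            (∀ t x : ℝ, |v t x| ≤ C * ρ ^ (2*(p:ℝ) + 1/2)) := by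
  obtain ⟨μ0, hμ0, C, hC, H⟩ := SDB.core p hm hmi
  have hφ := SDB.ph0_pos p
  refine ⟨min 1 μ0, by positivity, 2 * SDB.ph0 p, by positivity,
    C + 4 * (2 + m) ^ (2 * p + 1) * C, by positivity, ?_⟩
  intro ρ hρ hρM
  have hρ1 : ρ < 1 := hρM.trans_le (min_le_left _ _)
  have hρ0 : ρ < μ0 := hρM.trans_le (min_le_right _ _)
  have hμ : 0 < ρ ^ (2 * p) := by positivity
  have hμμ : ρ ^ (2 * p) ≤ μ0 := by
    refine le_trans ?_ hρ0.le
    exact pow_le_of_le_one hρ.le hρ1.le (by omega)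
  obtain ⟨z, ω, hA, hs, hR, hN, hωI, hre, him, hω, hz⟩ := H _ hμ hμμ
  have hω0 : 0 < ω := by linarith [hωI.1]
  have hc := SDB.coef_id hs hR hz
  have hpde := SDB.ev_pde hA hs hω hc
  have hy := SDB.Sy_s0.add hs
  have hAy := SDB.A_s0.add hA
  have hr : SDB.RD (SDB.it (SDB.s0 + z)) := hAy.it.RD
  have hdt := SDB.dt_it hy
  have hK : 0 ≤ C + 4 * (2 + m) ^ (2 * p + 1) * C := by positivity
  refine ⟨4 * ρ ^ (2 * p) * ω ^ (2 * p) * (SDB.ph p z).re, ω, ?_, ?_,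
    fun t x => ρ * (SDB.ev (SDB.it (SDB.s0 + z)) t x).re, ?_, ?_, ?_, ?_,
    fun t x => ρ * (SDB.ev (SDB.it z) t x).re, ?_, ?_⟩
  · have h1 : 1 ≤ ω ^ (2 * p) := one_le_pow₀ hωI.1
    calc 2 * SDB.ph0 p * ρ ^ (2 * p) = 4 * ρ ^ (2 * p) * 1 * (SDB.ph0 p / 2) := by ring
      _ ≤ _ := by gcongr
  · have h1 := (SDB.pow_range p hωI).2
    have e : ω ^ 2 - (1 + m) = 4 * (ρ ^ (2 * p) * ω ^ (2 * p + 1)) * (SDB.ph p z).im := by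
      rw [hω]; ring
    rw [e, abs_mul, abs_of_pos (by positivity)]
    calc _ ≤ 4 * (ρ ^ (2 * p) * (2 + m) ^ (2 * p + 1)) * (C * ρ ^ (2 * p)) := by gcongr
      _ = 4 * (2 + m) ^ (2 * p + 1) * C * ρ ^ (2 * p + 2 * p) := by rw [pow_add]; ring
      _ ≤ 4 * (2 + m) ^ (2 * p + 1) * C * ρ ^ (2 * p + 1) := by
        have := pow_le_pow_of_le_one hρ.le hρ1.le (show 2 * p + 1 ≤ 2 * p + 2 * p by omega)
        gcongr
      _ ≤ _ := by
        have : 0 ≤ C * ρ ^ (2 * p + 1) := by positivity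
        linarith
  · exact contDiff_const.mul (Complex.reCLM.contDiff.comp (SDB.ev_contDiff k0 hr))
  · intro t x
    have d1 : pdt (fun t x => ρ * (SDB.ev (SDB.it (SDB.s0 + z)) t x).re) =
        fun t x => ρ * (SDB.ev (SDB.dt (SDB.it (SDB.s0 + z))) t x).re := by
      ext t x; simp only [pdt, deriv_const_mul_field, SDB.re_dt hr]
    have d2 : pdtt (fun t x => ρ * (SDB.ev (SDB.it (SDB.s0 + z)) t x).re) =
        fun t x => ρ * (SDB.ev (SDB.dt (SDB.dt (SDB.it (SDB.s0 + z)))) t x).re := by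
      ext t x; simp only [pdtt, d1, deriv_const_mul_field, SDB.re_dt hr.dt]
    have d3 : pdxx (fun t x => ρ * (SDB.ev (SDB.it (SDB.s0 + z)) t x).re) =
        fun t x => ρ * (SDB.ev (SDB.dx (SDB.dx (SDB.it (SDB.s0 + z)))) t x).re := by
      ext t x; simp only [pdxx, deriv_const_mul_field, SDB.re_dx hr, SDB.re_dx hr.dx]
    have d4 : pdtxx (fun t x => ρ * (SDB.ev (SDB.it (SDB.s0 + z)) t x).re) =
        fun t x => ρ * (SDB.ev (SDB.dt (SDB.dx (SDB.dx (SDB.it (SDB.s0 + z))))) t x).re := by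
      ext t x; simp only [pdtxx, d3, deriv_const_mul_field, SDB.re_dt hr.dx.dx]
    rw [d1, d2, d3, d4, hdt]
    have h := congrArg Complex.re (hpde t x)
    rw [hdt] at h
    have hreal := Complex.conj_eq_iff_re.1 (SDB.ev_real hy.conj t x)
    rw [← hreal] at h
    simp only [Complex.add_re, Complex.sub_re, ← Complex.ofReal_pow, ← Complex.ofReal_mul,
      Complex.re_ofReal_mul, Complex.ofReal_re] at h
    rw [mul_pow]
    linear_combination ρ * h
  · intro t
    obtain ⟨h1, h2⟩ := SDB.ev_bc (SDB.it_odd hy) t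
    simp [h1, h2]
  · intro t x
    simp only [SDB.ev_period]
  · intro t x
    have e : SDB.it (SDB.s0 + z) = SDB.it SDB.s0 + SDB.it z := by
      ext n; simp [SDB.it, add_div]
    simp only [e, SDB.ev_add SDB.A_s0.it.RD hA.it.RD, SDB.ev_it_s0, Complex.add_re,
      Complex.ofReal_re]
    ring
  · intro t x
    have h1 : |(SDB.ev (SDB.it z) t x).re| ≤ C * ρ ^ (2 * p) := by
      refine (Complex.abs_re_le_norm _).trans ((SDB.ev_norm_le hA.it t x).trans ?_)
      refine (SDB.N_mono hA (SDB.it_norm z)).trans ?_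
      rw [one_mul]; exact hN
    rw [abs_mul, abs_of_pos hρ]
    have h2 : ρ ^ (2 * p + 1) ≤ ρ ^ (2 * (p:ℝ) + 1/2) := by
      have := Real.rpow_le_rpow_of_exponent_ge hρ hρ1.le
        (show 2 * (p:ℝ) + 1/2 ≤ ((2 * p + 1 : ℕ) : ℝ) by push_cast; linarith)
      rwa [Real.rpow_natCast] at this
    calc _ ≤ ρ * (C * ρ ^ (2 * p)) := by gcongr
      _ = C * ρ ^ (2 * p + 1) := by ring
      _ ≤ (C + 4 * (2 + m) ^ (2 * p + 1) * C) * ρ ^ (2 * (p:ℝ) + 1/2) := by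
        gcongr
        have : 0 ≤ 4 * (2 + m) ^ (2 * p + 1) * C := by positivity
        linarith
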